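/- arXiv:2411.05598 — 2 statements merged into one kernel-verified Lean document; each statement's English description precedes it below -/
import Mathlib

section
/- Let H and H' be Hilbert spaces. Every imprimitivity K(H')-K(H) bimodule X is isomorphic (as an imprimitivity bimodule) to K(H, H'), the compact operators from H to H'; in particular X ≅ H' ⊗_ℂ H, where H' ⊗_ℂ H carries the standard K(H')-K(H) imprimitivity bimodule structure. -/
open ContinuousLinearMap

noncomputable section

variable (H H' : Type)
  [NormedAddCommGroup H] [InnerProductSpace ℂ H] [CompleteSpace H]
  [NormedAddCommGroup H'] [InnerProductSpace ℂ H'] [CompleteSpace H']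

/-- An imprimitivity `K(H')`–`K(H)` bimodule: a full left Hilbert `K(H')`-module and full
right Hilbert `K(H)`-module satisfying `_{K(H')}⟨x,y⟩·z = x·⟨y,z⟩_{K(H)}`, with each algebra
acting by adjointables for the other structure.  The actions of the compact operators are
recorded as actions of bounded operators (a non-degenerate action of `K(H)` extends uniquely
to `B(H)`); the inner products take compact values and are full onto the compacts. -/
structure ImpBimod : Type 1 where
  X : Type
  [grp : NormedAddCommGroup X]
  [nsc : NormedSpace ℂ X]
  [cpl : CompleteSpace X]
  smR : X → (H →L[ℂ] H) → X
  smL : (H' →L[ℂ] H') → X → X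
  ipR : X → X → (H →L[ℂ] H)
  ipL : X → X → (H' →L[ℂ] H')
  smR_add : ∀ x y T, smR (x + y) T = smR x T + smR y T
  smR_add' : ∀ x T T', smR x (T + T') = smR x T + smR x T'
  smR_mul : ∀ x T T', smR (smR x T) T' = smR x (T.comp T')
  smR_smul : ∀ (c : ℂ) x T, smR (c • x) T = c • smR x T
  smL_add : ∀ T x y, smL T (x + y) = smL T x + smL T y
  smL_add' : ∀ T T' x, smL (T + T') x = smL T x + smL T' x
  smL_mul : ∀ T T' x, smL (T.comp T') x = smL T (smL T' x)
  smL_smul : ∀ (c : ℂ) T x, smL (c • T) x = c • smL T x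
  ipR_add : ∀ x y z, ipR x (y + z) = ipR x y + ipR x z
  ipR_smul : ∀ (c : ℂ) x y, ipR x (c • y) = c • ipR x y
  ipR_smR : ∀ x y T, ipR x (smR y T) = (ipR x y).comp T
  ipR_star : ∀ x y, adjoint (ipR x y) = ipR y x
  ipR_pos : ∀ x, (ipR x x).IsPositive
  ipR_compact : ∀ x y, IsCompactOperator (ipR x y)
  ipL_add : ∀ x y z, ipL (x + y) z = ipL x z + ipL y z
  ipL_smul : ∀ (c : ℂ) x y, ipL (c • x) y = c • ipL x y
  ipL_smL : ∀ T x y, ipL (smL T x) y = T.comp (ipL x y)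
  ipL_star : ∀ x y, adjoint (ipL x y) = ipL y x
  ipL_pos : ∀ x, (ipL x x).IsPositive
  ipL_compact : ∀ x y, IsCompactOperator (ipL x y)
  ipR_adjL : ∀ T x y, ipR (smL T x) y = ipR x (smL (adjoint T) y)
  ipL_adjR : ∀ T x y, ipL (smR x T) y = ipL x (smR y (adjoint T))
  compat : ∀ x y z, smL (ipL x y) z = smR x (ipR y z)
  normR : ∀ x, ‖x‖ ^ 2 = ‖ipR x x‖
  normL : ∀ x, ‖x‖ ^ 2 = ‖ipL x x‖
  fullR : closure (Submodule.span ℂ {T | ∃ x y, T = ipR x y} : Set (H →L[ℂ] H))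
    = {T : H →L[ℂ] H | IsCompactOperator (⇑T)}
  fullL : closure (Submodule.span ℂ {T | ∃ x y, T = ipL x y} : Set (H' →L[ℂ] H'))
    = {T : H' →L[ℂ] H' | IsCompactOperator (⇑T)}

attribute [instance] ImpBimod.grp ImpBimod.nsc ImpBimod.cpl

section Helpers

variable {H H'}

open InnerProductSpace

/-- If `T* T` is compact then so is `T`. -/
theorem compact_of_adjoint_comp (T : H →L[ℂ] H')
    (hT : IsCompactOperator ((adjoint T).comp T)) : IsCompactOperator T := by
  have htb : TotallyBounded (T '' Metric.ball (0 : H) 1) := by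
    rw [Metric.totallyBounded_iff]
    intro ε hε
    have hc : IsCompact (closure ((adjoint T).comp T '' Metric.ball (0 : H) 1)) :=
      IsCompactOperator.isCompact_closure_image_ball
        (f := (((adjoint T).comp T : H →L[ℂ] H) : H →ₗ[ℂ] H)) hT 1
    obtain ⟨t, hts, htf, hcov⟩ := exists_finite_cover_balls_of_isCompact_closure hc
      (show (0 : ℝ) < ε ^ 2 / 2 by positivity)
    have hts' : ∀ y ∈ t, ∃ x, x ∈ Metric.ball (0 : H) 1 ∧ ((adjoint T).comp T) x = y :=
      fun y hy => hts hy
    choose! g hg using hts'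
    refine ⟨(fun y => T (g y)) '' t, htf.image _, ?_⟩
    rintro _ ⟨x, hx, rfl⟩
    obtain ⟨y, hy, hxy⟩ := Set.mem_iUnion₂.1 (hcov ⟨x, hx, rfl⟩)
    refine Set.mem_iUnion₂.2 ⟨_, ⟨y, hy, rfl⟩, ?_⟩
    obtain ⟨hgy, hgy'⟩ := hg y hy
    rw [Metric.mem_ball, dist_eq_norm] at hxy ⊢
    rw [← hgy', ← map_sub] at hxy
    rw [← map_sub]
    set d := x - g y with hd
    have hdn : ‖d‖ ≤ 2 := by
      have h1 := norm_sub_le x (g y)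
      rw [mem_ball_zero_iff] at hx hgy
      linarith
    have h2 : ‖T d‖ ^ 2 ≤ ‖((adjoint T).comp T) d‖ * ‖d‖ := by
      have h3 : ((‖T d‖ ^ 2 : ℝ) : ℂ) = inner ℂ (((adjoint T).comp T) d) d := by
        rw [comp_apply, adjoint_inner_left, inner_self_eq_norm_sq_to_K]
        norm_cast
      have h4 := norm_inner_le_norm (𝕜 := ℂ) (((adjoint T).comp T) d) d
      rw [← h3] at h4
      simpa using h4
    have h5 : ‖T d‖ ^ 2 < ε ^ 2 := by
      have := norm_nonneg (((adjoint T).comp T) d)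
      nlinarith
    exact lt_of_pow_lt_pow_left₀ 2 hε.le h5
  refine ⟨closure (T '' Metric.ball (0 : H) 1), htb.closure.isCompact_of_isClosed isClosed_closure, ?_⟩
  filter_upwards [Metric.ball_mem_nhds (0 : H) one_pos] with x hx
  exact subset_closure ⟨x, hx, rfl⟩

theorem opNorm_le_of_unit_norm' (T : H →L[ℂ] H') (C : ℝ) (hC : 0 ≤ C)
    (h : ∀ x ∈ Metric.ball (0 : H) 1, ‖T x‖ ≤ C) : ‖T‖ ≤ C := by
  refine opNorm_le_bound _ hC fun x => ?_
  have key : ∀ s : ℝ, ‖x‖ < s → ‖T x‖ ≤ C * s := by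
    intro s hs
    have hs0 : 0 < s := lt_of_le_of_lt (norm_nonneg x) hs
    have h1 := h ((s : ℂ)⁻¹ • x) (by
      rw [mem_ball_zero_iff, norm_smul, norm_inv, Complex.norm_real, Real.norm_of_nonneg hs0.le,
        inv_mul_lt_iff₀ hs0]
      simpa using hs)
    rw [map_smul, norm_smul, norm_inv, Complex.norm_real, Real.norm_of_nonneg hs0.le,
      inv_mul_le_iff₀ hs0] at h1
    linarith
  refine le_of_forall_pos_le_add fun δ hδ => ?_
  have h2 := key (‖x‖ + δ / (C + 1)) (by linarith [show 0 < δ / (C + 1) by positivity])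
  have h3 : C * (δ / (C + 1)) ≤ δ := by
    rw [mul_div_assoc', div_le_iff₀ (by positivity)]
    nlinarith
  linarith

/-- Compact operators are norm limits of finite rank ones. -/
theorem compact_mem_of_rankOne (V : Submodule ℂ (H →L[ℂ] H')) (hV : IsClosed (V : Set (H →L[ℂ] H')))
    (h1 : ∀ (v : H') (h : H), rankOne ℂ v h ∈ V) (T : H →L[ℂ] H') (hT : IsCompactOperator T) :
    T ∈ V := by
  have : T ∈ closure (V : Set (H →L[ℂ] H')) := by
    rw [Metric.mem_closure_iff]
    intro ε hε
    have hc : IsCompact (closure (T '' Metric.ball (0 : H) 1)) :=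
      IsCompactOperator.isCompact_closure_image_ball (f := (T : H →ₗ[ℂ] H')) hT 1
    obtain ⟨t, hts, htf, hcov⟩ := exists_finite_cover_balls_of_isCompact_closure hc
      (show (0 : ℝ) < ε / 2 by positivity)
    let U : Submodule ℂ H' := Submodule.span ℂ t
    haveI : FiniteDimensional ℂ U := FiniteDimensional.span_of_finite ℂ htf
    refine ⟨U.starProjection.comp T, ?_, ?_⟩
    · rw [(stdOrthonormalBasis ℂ U).starProjection_eq_sum_rankOne]
      have : (∑ i, rankOne ℂ ((stdOrthonormalBasis ℂ U i : U) : H')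
          ((stdOrthonormalBasis ℂ U i : U) : H')).comp T
          = ∑ i, rankOne ℂ ((stdOrthonormalBasis ℂ U i : U) : H')
            (adjoint T ((stdOrthonormalBasis ℂ U i : U) : H')) := by
        ext x
        simp [adjoint_inner_left]
      rw [SetLike.mem_coe, this]
      exact Submodule.sum_mem _ fun i _ => h1 _ _
    · rw [dist_eq_norm]
      refine lt_of_le_of_lt (b := ε / 2) ?_ (by linarith)
      refine opNorm_le_of_unit_norm' (T - U.starProjection.comp T) (ε / 2) (by positivity) ?_
      intro x hx
      obtain ⟨y, hy, hxy⟩ := Set.mem_iUnion₂.1 (hcov ⟨x, hx, rfl⟩)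
      rw [Metric.mem_ball, dist_eq_norm] at hxy
      rw [sub_apply, comp_apply, Submodule.starProjection_minimal]
      refine le_trans (ciInf_le ⟨0, ?_⟩ (⟨y, Submodule.subset_span hy⟩ : U)) hxy.le
      rintro _ ⟨w, rfl⟩
      exact norm_nonneg _
  rwa [hV.closure_eq] at this

namespace ImpBimod

variable (M : ImpBimod H H')

theorem ipR_sub (x y z : M.X) : M.ipR x (y - z) = M.ipR x y - M.ipR x z := by
  rw [sub_eq_add_neg, ← neg_one_smul ℂ z, M.ipR_add, M.ipR_smul]; simp [sub_eq_add_neg]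

theorem eq_zero_of_ipR {x : M.X} (h : M.ipR x x = 0) : x = 0 := by
  have := M.normR x
  rw [h] at this
  simpa using this

theorem eq_zero_of_ipL {x : M.X} (h : M.ipL x x = 0) : x = 0 := by
  have := M.normL x
  rw [h] at this
  simpa using this

theorem ext_ipR {x y : M.X} (h : ∀ z, M.ipR z x = M.ipR z y) : x = y := by
  rw [← sub_eq_zero]
  apply M.eq_zero_of_ipR
  rw [ipR_sub, h, sub_self]

theorem smR_smul' (c : ℂ) (x : M.X) (T : H →L[ℂ] H) : M.smR x (c • T) = c • M.smR x T := by
  apply M.ext_ipR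
  intro z
  rw [M.ipR_smR, M.ipR_smul, M.ipR_smR, comp_smul]

theorem smL_smR (T : H' →L[ℂ] H') (x : M.X) (S : H →L[ℂ] H) :
    M.smL T (M.smR x S) = M.smR (M.smL T x) S := by
  apply M.ext_ipR
  intro z
  have h : ∀ y, M.ipR z (M.smL T y) = M.ipR (M.smL (adjoint T) z) y := fun y => by
    rw [M.ipR_adjL, adjoint_adjoint]
  rw [M.ipR_smR, h, h, M.ipR_smR]

theorem ipR_smR_left (x y : M.X) (T : H →L[ℂ] H) :
    M.ipR (M.smR x T) y = (adjoint T).comp (M.ipR x y) := by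
  rw [← M.ipR_star, M.ipR_smR, adjoint_comp, M.ipR_star]

/-- the underlying map -/
def uFun (e : H) (f : H') (x0 : M.X) (x : M.X) (h : H) : H' :=
  M.ipL (M.smR x (rankOne ℂ h e)) x0 f

variable {e : H} {f : H'} {x0 : M.X}

theorem inner_uFun (he : M.smR x0 (rankOne ℂ e e) = x0)
    (hf : inner ℂ f (M.ipL x0 x0 f) = 1) (x y : M.X) (h k : H) :
    inner ℂ (M.uFun e f x0 x h) (M.uFun e f x0 y k) = inner ℂ h (M.ipR x y k) := by
  unfold uFun
  rw [← adjoint_inner_right, M.ipL_star, ← comp_apply, ← M.ipL_smL, M.compat, M.ipR_smR,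
    M.ipR_smR_left, adjoint_rankOne]
  have : ((rankOne ℂ e h).comp (M.ipR x y)).comp (rankOne ℂ k e)
      = (inner ℂ h (M.ipR x y k) : ℂ) • rankOne ℂ e e := by
    ext z
    simp [smul_smul, mul_comm]
  rw [this, M.smR_smul', he, M.ipL_smul, smul_apply, inner_smul_right, hf, mul_one]

theorem norm_uFun (he : M.smR x0 (rankOne ℂ e e) = x0)
    (hf : inner ℂ f (M.ipL x0 x0 f) = 1) (x : M.X) (h : H) :
    ‖M.uFun e f x0 x h‖ ≤ ‖x‖ * ‖h‖ := by
  have h1 := M.inner_uFun he hf x x h h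
  have h2 : ‖M.uFun e f x0 x h‖ ^ 2 ≤ (‖x‖ * ‖h‖) ^ 2 := by
    have h3 : ‖M.uFun e f x0 x h‖ ^ 2 = ‖(inner ℂ h (M.ipR x x h) : ℂ)‖ := by
      rw [← h1, inner_self_eq_norm_sq_to_K]
      simp
    rw [h3]
    calc _ ≤ ‖h‖ * ‖M.ipR x x h‖ := norm_inner_le_norm _ _
      _ ≤ ‖h‖ * (‖M.ipR x x‖ * ‖h‖) := by gcongr; exact le_opNorm _ _
      _ = _ := by rw [← M.normR]; ring
  exact le_of_sq_le_sq h2 (by positivity)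

/-- the isomorphism, as a map into bounded operators -/
def uMap (he : M.smR x0 (rankOne ℂ e e) = x0)
    (hf : inner ℂ f (M.ipL x0 x0 f) = 1) : M.X →ₗ[ℂ] (H →L[ℂ] H') where
  toFun x := LinearMap.mkContinuous
    { toFun := M.uFun e f x0 x
      map_add' := fun h k => by simp [uFun, M.smR_add', M.ipL_add]
      map_smul' := fun c h => by simp [uFun, M.smR_smul', M.ipL_smul] } ‖x‖
    (M.norm_uFun he hf x)
  map_add' x y := by
    ext h
    change M.uFun e f x0 (x + y) h = M.uFun e f x0 x h + M.uFun e f x0 y h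
    simp [uFun, M.smR_add, M.ipL_add]
  map_smul' c x := by
    ext h
    change M.uFun e f x0 (c • x) h = c • M.uFun e f x0 x h
    simp [uFun, M.smR_smul, M.ipL_smul]

theorem uMap_apply (he : M.smR x0 (rankOne ℂ e e) = x0)
    (hf : inner ℂ f (M.ipL x0 x0 f) = 1) (x : M.X) (h : H) :
    M.uMap he hf x h = M.ipL (M.smR x (rankOne ℂ h e)) x0 f := rfl

theorem uMap_ipR (he : M.smR x0 (rankOne ℂ e e) = x0)
    (hf : inner ℂ f (M.ipL x0 x0 f) = 1) (x y : M.X) :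
    M.ipR x y = (adjoint (M.uMap he hf x)).comp (M.uMap he hf y) := by
  ext k
  apply ext_inner_left ℂ
  intro h
  rw [comp_apply, adjoint_inner_right]
  exact (M.inner_uFun he hf x y h k).symm

theorem uMap_smR (he : M.smR x0 (rankOne ℂ e e) = x0)
    (hf : inner ℂ f (M.ipL x0 x0 f) = 1) (x : M.X) (T : H →L[ℂ] H) :
    M.uMap he hf (M.smR x T) = (M.uMap he hf x).comp T := by
  ext h
  rw [comp_apply, uMap_apply, uMap_apply, M.smR_mul, comp_rankOne]

theorem uMap_smL (he : M.smR x0 (rankOne ℂ e e) = x0)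
    (hf : inner ℂ f (M.ipL x0 x0 f) = 1) (T : H' →L[ℂ] H') (x : M.X) :
    M.uMap he hf (M.smL T x) = T.comp (M.uMap he hf x) := by
  ext h
  rw [comp_apply, uMap_apply, uMap_apply, ← M.smL_smR, M.ipL_smL, comp_apply]

theorem uMap_x0 (he : M.smR x0 (rankOne ℂ e e) = x0)
    (hf : inner ℂ f (M.ipL x0 x0 f) = 1) : inner ℂ f (M.uMap he hf x0 e) = 1 := by
  rw [uMap_apply, he, hf]

theorem uMap_ipL (he : M.smR x0 (rankOne ℂ e e) = x0)
    (hf : inner ℂ f (M.ipL x0 x0 f) = 1) (x y : M.X) :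
    M.ipL x y = (M.uMap he hf x).comp (adjoint (M.uMap he hf y)) := by
  ext v
  have h1 := M.uMap_smL he hf (M.ipL x y) (M.smL (rankOne ℂ v f) x0)
  rw [M.compat, uMap_smR, uMap_ipR M he hf, uMap_smL] at h1
  have h2 := congrArg (fun T => T e) h1
  simpa [M.uMap_x0 he hf] using h2.symm

theorem uMap_norm (he : M.smR x0 (rankOne ℂ e e) = x0)
    (hf : inner ℂ f (M.ipL x0 x0 f) = 1) (x : M.X) : ‖M.uMap he hf x‖ = ‖x‖ := by
  have h1 := M.normR x
  rw [M.uMap_ipR he hf, norm_adjoint_comp_self, ← sq] at h1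
  exact ((sq_eq_sq₀ (norm_nonneg _) (norm_nonneg _)).1 h1).symm

theorem uMap_range (he : M.smR x0 (rankOne ℂ e e) = x0)
    (hf : inner ℂ f (M.ipL x0 x0 f) = 1) :
    Set.range (M.uMap he hf) = {T : H →L[ℂ] H' | IsCompactOperator (⇑T)} := by
  apply Set.Subset.antisymm
  · rintro _ ⟨x, rfl⟩
    apply compact_of_adjoint_comp
    rw [← M.uMap_ipR he hf]
    exact M.ipR_compact x x
  · intro T hT
    have hiso : Isometry (M.uMap he hf) :=
      AddMonoidHomClass.isometry_of_norm _ (M.uMap_norm he hf)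
    have := compact_mem_of_rankOne (LinearMap.range (M.uMap he hf))
      (by rw [LinearMap.coe_range]; exact hiso.isClosedEmbedding.isClosed_range) ?_ T hT
    · simpa using this
    · intro v h
      refine ⟨M.smR (M.smL (rankOne ℂ v f) x0) (rankOne ℂ e h), ?_⟩
      rw [uMap_smR, uMap_smL]
      ext k
      simp [M.uMap_x0 he hf]

theorem exists_unit (A : H →L[ℂ] H) (hA : A ≠ 0) : ∃ e : H, ‖e‖ = 1 ∧ inner ℂ e (A e) ≠ 0 := by
  have h1 : ∃ h, inner ℂ (A h) h ≠ (0 : ℂ) := by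
    by_contra! hc
    apply hA
    have := (inner_map_self_eq_zero (A : H →ₗ[ℂ] H)).1 hc
    ext v
    exact congrArg (fun T => T v) this
  obtain ⟨h, hh⟩ := h1
  have hn : h ≠ 0 := by rintro rfl; simp at hh
  have hn' : (‖h‖ : ℂ) ≠ 0 := by simpa using hn
  refine ⟨(‖h‖ : ℂ)⁻¹ • h, ?_, ?_⟩
  · simp [norm_smul, hn]
  · have : inner ℂ h (A h) ≠ (0 : ℂ) := by
      intro h0
      apply hh
      rw [← inner_conj_symm, h0, map_zero]
    simp [inner_smul_left, inner_smul_right, hn, this]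

theorem exists_data (z : M.X) (hz : z ≠ 0) : ∃ (e : H) (f : H') (x0 : M.X),
    M.smR x0 (rankOne ℂ e e) = x0 ∧ inner ℂ f (M.ipL x0 x0 f) = (1 : ℂ) := by
  obtain ⟨e, he, hne⟩ := exists_unit (M.ipR z z) fun h => hz (M.eq_zero_of_ipR h)
  set x0 := M.smR z (rankOne ℂ e e) with hx0
  have hx0n : x0 ≠ 0 := by
    intro h0
    have h1 : M.ipR x0 x0 = 0 := by
      have := M.normR x0
      rw [h0] at this ⊢
      simpa using this.symm
    rw [hx0, M.ipR_smR, M.ipR_smR_left, adjoint_rankOne] at h1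
    have h2 := congrArg (fun T => inner ℂ e (T e)) h1
    simp [he, inner_self_eq_norm_sq_to_K] at h2
    exact hne h2
  obtain ⟨f, hf, hnf⟩ := exists_unit (M.ipL x0 x0) fun h => hx0n (M.eq_zero_of_ipL h)
  have hpos := (M.ipL_pos x0).inner_nonneg_right f
  obtain ⟨r, hr, hr'⟩ : ∃ r : ℝ, 0 ≤ r ∧ inner ℂ f (M.ipL x0 x0 f) = (r : ℂ) := by
    obtain ⟨h1, h2⟩ := Complex.le_def.1 hpos
    refine ⟨_, h1, ?_⟩
    apply Complex.ext <;> simp [← h2]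
  have hr0 : r ≠ 0 := by rintro rfl; exact hnf (by simpa using hr')
  refine ⟨e, ((Real.sqrt r : ℂ))⁻¹ • f, x0, ?_, ?_⟩
  · rw [hx0, M.smR_mul]
    congr 1
    exact isIdempotentElem_rankOne_self he
  · rw [map_smul, inner_smul_left, inner_smul_right, hr']
    have h3 : (Real.sqrt r : ℂ) * Real.sqrt r = r := by
      rw [← Complex.ofReal_mul, Real.mul_self_sqrt hr]
    have h4 : (Real.sqrt r : ℂ) ≠ 0 := by
      intro h; rw [h] at h3; simp at h3; exact hr0 (by exact_mod_cast h3.symm)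
    rw [← h3]
    simp
    field_simp

end ImpBimod

end Helpers

/-- every imprimitivity `K(H')`–`K(H)` bimodule `X` is isomorphic, as an
imprimitivity bimodule, to `K(H, H')`, the compact operators from `H` to `H'` (with inner
products `⟨T,S⟩_{K(H)} = T*S`, `_{K(H')}⟨T,S⟩ = TS*` and composition actions); in particular
`X ≅ H' ⊗_ℂ H`, since the standard bimodule `H' ⊗_ℂ H` is canonically isomorphic to
`K(H, H')`. -/
theorem stmt16 (M : ImpBimod H H') :
    ∃ u : M.X → (H →L[ℂ] H'),
      Function.Injective u ∧
      Set.range u = {T : H →L[ℂ] H' | IsCompactOperator (⇑T)} ∧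
      (∀ x y, u (x + y) = u x + u y) ∧
      (∀ (c : ℂ) x, u (c • x) = c • u x) ∧
      (∀ x T, u (M.smR x T) = (u x).comp T) ∧
      (∀ T x, u (M.smL T x) = T.comp (u x)) ∧
      (∀ x y, M.ipR x y = (adjoint (u x)).comp (u y)) ∧
      (∀ x y, M.ipL x y = (u x).comp (adjoint (u y))) := by
  by_cases hX : ∃ z : M.X, z ≠ 0
  · obtain ⟨z, hz⟩ := hX
    obtain ⟨e, f, x0, he, hf⟩ := M.exists_data z hz
    have hiso : Isometry (M.uMap he hf) :=
      AddMonoidHomClass.isometry_of_norm _ (M.uMap_norm he hf)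
    exact ⟨M.uMap he hf, hiso.injective, M.uMap_range he hf, map_add _, map_smul _,
      M.uMap_smR he hf, M.uMap_smL he hf, M.uMap_ipR he hf, M.uMap_ipL he hf⟩
  · push Not at hX
    have hR : ∀ x y, M.ipR x y = 0 := fun x y => by
      have := M.ipR_smul 0 x y
      rwa [hX ((0 : ℂ) • y), ← hX y, zero_smul] at this
    have hL : ∀ x y, M.ipL x y = 0 := fun x y => by
      have := M.ipL_smul 0 x y
      rwa [hX ((0 : ℂ) • x), ← hX x, zero_smul] at this
    have hH : ∀ h : H, h = 0 := by
      intro h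
      have h1 : IsCompactOperator (InnerProductSpace.rankOne ℂ h h : H →L[ℂ] H) := by
        rw [InnerProductSpace.rankOne_def']
        exact (isCompactOperator_id (E := ℂ)).clm_comp (toSpanSingleton ℂ h) |>.comp_clm
          (innerSL ℂ h)
      have h2 : InnerProductSpace.rankOne ℂ h h ∈
        {T : H →L[ℂ] H | IsCompactOperator (⇑T)} := h1
      rw [← M.fullR] at h2
      have h3 : (Submodule.span ℂ {T | ∃ x y, T = M.ipR x y} : Submodule ℂ (H →L[ℂ] H)) = ⊥ := by
        rw [Submodule.span_eq_bot]
        rintro _ ⟨x, y, rfl⟩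
        exact hR x y
      rw [h3] at h2
      simpa using h2
    have hT : ∀ T : H →L[ℂ] H', T = 0 := fun T => by
      ext h; rw [hH h]; simp
    refine ⟨fun _ => 0, fun x y _ => by rw [hX x, hX y], ?_, ?_, ?_, ?_, ?_, ?_, ?_⟩
    · ext T
      rw [hT T]
      exact ⟨fun _ => isCompactOperator_zero, fun _ => ⟨0, rfl⟩⟩
    · simp
    · simp
    · simp
    · simp
    · intro x y; rw [hR]; simp
    · intro x y; rw [hL]; simp
end
end

section
/- Let A and B be finite essential square matrices over ℕ, indexed by V and W, and let X(A), X(B) be their graph correspondences over c(V) and c(W). If X(A) and X(B) are strong shift equivalent with lag m as C*-correspondences, then the matrices A and B are strong shift equivalent with lag m, i.e., there exist finite ℕ-matrices C_1,...,C_m and D_1,...,D_m with A = C_1 D_1, D_i C_i = C_{i+1} D_{i+1} for i = 1,...,m-1, and D_m C_m = B. -/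
/-! Basic framework: C*-correspondences over (possibly non-unital) C*-algebras,
interior tensor products (characterized by their universal properties),
closed ideals, and unitary isomorphisms of correspondences. -/

noncomputable section

/-- A (non-degenerate) A–B C*-correspondence: a right Hilbert `B`-module `X`
together with a left action of `A` by adjointable operators. -/
structure Corr (A B : Type) [NonUnitalCStarAlgebra A] [NonUnitalCStarAlgebra B] : Type 1 where
  X : Type
  [grp : NormedAddCommGroup X]
  [nsc : NormedSpace ℂ X]
  [cpl : CompleteSpace X]
  /-- the right action of `B` -/
  sm : X → B → X
  /-- the `B`-valued inner product (linear in the second variable) -/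
  ip : X → X → B
  /-- the left action of `A` -/
  φ : A → X → X
  sm_add : ∀ x y b, sm (x + y) b = sm x b + sm y b
  sm_add' : ∀ x b c, sm x (b + c) = sm x b + sm x c
  sm_mul : ∀ x b c, sm (sm x b) c = sm x (b * c)
  sm_smul : ∀ (t : ℂ) x b, sm (t • x) b = t • sm x b
  sm_smul' : ∀ (t : ℂ) x b, sm x (t • b) = t • sm x b
  ip_add : ∀ x y z, ip x (y + z) = ip x y + ip x z
  ip_smul : ∀ (t : ℂ) x y, ip x (t • y) = t • ip x y
  ip_sm : ∀ x y b, ip x (sm y b) = ip x y * b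
  ip_star : ∀ x y, star (ip x y) = ip y x
  ip_pos : ∀ x, ∃ b, ip x x = star b * b
  ip_norm : ∀ x, ‖x‖ ^ 2 = ‖ip x x‖
  φ_add : ∀ a x y, φ a (x + y) = φ a x + φ a y
  φ_add' : ∀ a b x, φ (a + b) x = φ a x + φ b x
  φ_smul : ∀ a (t : ℂ) x, φ a (t • x) = t • φ a x
  φ_smul' : ∀ (t : ℂ) a x, φ (t • a) x = t • φ a x
  φ_mul : ∀ a b x, φ (a * b) x = φ a (φ b x)
  φ_adj : ∀ a x y, ip (φ a x) y = ip x (φ (star a) y)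
  /-- non-degeneracy of the left action -/
  nondeg : closure (Submodule.span ℂ {z | ∃ a x, z = φ a x} : Set X) = Set.univ

attribute [instance] Corr.grp Corr.nsc Corr.cpl

variable {A B C : Type} [NonUnitalCStarAlgebra A] [NonUnitalCStarAlgebra B]
  [NonUnitalCStarAlgebra C]

/-- `Z.setR I` is the closed submodule `Z·I` of `Z`. -/
def Corr.setR (Z : Corr A B) (I : Set B) : Set Z.X :=
  closure (Submodule.span ℂ {x | ∃ ξ b, b ∈ I ∧ x = Z.sm ξ b} : Set Z.X)

/-- `Z.setL I` is the closed subspace `I·Z` of `Z`. -/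
def Corr.setL (Z : Corr A B) (I : Set A) : Set Z.X :=
  closure (Submodule.span ℂ {x | ∃ a ξ, a ∈ I ∧ x = Z.φ a ξ} : Set Z.X)

/-- `Z⁻¹(I) = {a ∈ A : φ_Z(a)Z ⊆ ZI}`. -/
def Corr.inv (Z : Corr A B) (I : Set B) : Set A := {a | ∀ ξ, Z.φ a ξ ∈ Z.setR I}

/-- The closed ideal of `B` generated by the inner products of `Z`. -/
def Corr.ipSet (Z : Corr A B) : Set B :=
  closure (Submodule.span ℂ {b | ∃ x y, b = Z.ip x y} : Set B)

/-- A generalized compact operator on the underlying Hilbert module of a correspondence: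
one that is approximable in operator norm by finite sums of "rank one" operators
`θ_{ξ,η} : z ↦ ξ·⟨η,z⟩`. -/
def Corr.IsCompactOp (Z : Corr A B) (f : Z.X → Z.X) : Prop :=
  ∀ ε > (0 : ℝ), ∃ (n : ℕ) (ξ η : Fin n → Z.X),
    ∀ z, ‖f z - ∑ i, Z.sm (ξ i) (Z.ip (η i) z)‖ ≤ ε * ‖z‖

/-- A closed (two-sided, automatically self-adjoint) ideal of a C*-algebra, as a set. -/
structure IsCIdeal {B : Type} [NonUnitalCStarAlgebra B] (I : Set B) : Prop where
  isClosed : IsClosed I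
  zero_mem : (0 : B) ∈ I
  add_mem : ∀ x y, x ∈ I → y ∈ I → x + y ∈ I
  smul_mem : ∀ (t : ℂ) x, x ∈ I → t • x ∈ I
  mul_left_mem : ∀ b x, x ∈ I → b * x ∈ I
  mul_right_mem : ∀ b x, x ∈ I → x * b ∈ I

/-- `t : Z₁ × Z₂ → T` exhibits `T` as the interior tensor product `Z₁ ⊗_B Z₂`. -/
structure IsTensor (Z₁ : Corr A B) (Z₂ : Corr B C) (T : Corr A C)
    (t : Z₁.X → Z₂.X → T.X) : Prop where
  add_left : ∀ x x' y, t (x + x') y = t x y + t x' y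
  add_right : ∀ x y y', t x (y + y') = t x y + t x y'
  smul_left : ∀ (c : ℂ) x y, t (c • x) y = c • t x y
  balanced : ∀ x b y, t (Z₁.sm x b) y = t x (Z₂.φ b y)
  sm_right : ∀ x y c, t x (Z₂.sm y c) = T.sm (t x y) c
  act_left : ∀ a x y, T.φ a (t x y) = t (Z₁.φ a x) y
  inner : ∀ x x' y y', T.ip (t x y) (t x' y') = Z₂.ip y (Z₂.φ (Z₁.ip x x') y')
  dense : closure (Submodule.span ℂ {z | ∃ x y, z = t x y} : Set T.X) = Set.univ

/-- `X ≅ Z₁ ⊗ Z₂` (unitary isomorphism with the interior tensor product). -/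
def IsTensorProd (Z₁ : Corr A B) (Z₂ : Corr B C) (T : Corr A C) : Prop :=
  ∃ t, IsTensor Z₁ Z₂ T t

/-- A unitary isomorphism of A–B correspondences. -/
def CorrIso (Z W : Corr A B) : Prop :=
  ∃ u : Z.X → W.X, Function.Surjective u ∧ (∀ x y, u (x + y) = u x + u y) ∧
    (∀ (c : ℂ) x, u (c • x) = c • u x) ∧ (∀ a x, u (Z.φ a x) = W.φ a (u x)) ∧
    (∀ x b, u (Z.sm x b) = W.sm (u x) b) ∧ (∀ x y, W.ip (u x) (u y) = Z.ip x y)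

end

noncomputable section

/-- The edge set `E_A = {(v, α, w) : 0 ≤ α < A_{v w}}` of a matrix over `ℕ`. -/
def Edge {α β : Type} (F : Matrix α β ℕ) : Type :=
  {x : α × ℕ × β // x.2.1 < F x.1 x.2.2}

def Edge.src {α β : Type} {F : Matrix α β ℕ} (e : Edge F) : α := e.1.1

def Edge.tgt {α β : Type} {F : Matrix α β ℕ} (e : Edge F) : β := e.1.2.2

/-- A matrix is essential if it has no zero rows and no zero columns. -/
def MatEssential {V : Type} (A : Matrix V V ℕ) : Prop :=
  (∀ v, ∃ w, A v w ≠ 0) ∧ (∀ w, ∃ v, A v w ≠ 0)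

open Classical

/-- `Z` is (unitarily isomorphic to) the graph correspondence `X(A)` over `c(V)`:
it has an orthonormal-type basis `δ_e`, `e ∈ E_A`, with
`⟨δ_e, δ_f⟩ = [e = f]·χ_{s(e)}`, `a·δ_e = a(r(e))δ_e`, `δ_e·b = b(s(e))δ_e`. -/
def IsGraphCorr {V : Type} [Fintype V] [DecidableEq V] (A : Matrix V V ℕ)
    (Z : Corr (V → ℂ) (V → ℂ)) : Prop :=
  ∃ δ : Edge A → Z.X,
    (∀ e f, Z.ip (δ e) (δ f)
      = if e = f then (fun v => if v = Edge.src e then 1 else 0) else 0) ∧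
    (∀ (a : V → ℂ) e, Z.φ a (δ e) = a (Edge.tgt e) • δ e) ∧
    (∀ e (b : V → ℂ), Z.sm (δ e) b = b (Edge.src e) • δ e) ∧
    closure (Submodule.span ℂ (Set.range δ) : Set Z.X) = Set.univ

/-- Strong shift equivalence of C*-correspondences with lag `m`: the `m`-step transitive
closure of the elementary strong shift relation `X ≅ R ⊗_B S`, `S ⊗_A R ≅ Y`
(over arbitrary coefficient C*-algebras). -/
inductive CorrSSE :
    ∀ (A : Type) (iA : NonUnitalCStarAlgebra A) (B : Type) (iB : NonUnitalCStarAlgebra B),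
      @Corr A A iA iA → @Corr B B iB iB → ℕ → Prop
  | elem : ∀ {A : Type} {iA : NonUnitalCStarAlgebra A}
      {B : Type} {iB : NonUnitalCStarAlgebra B}
      (X : @Corr A A iA iA) (Y : @Corr B B iB iB)
      (R : @Corr A B iA iB) (S : @Corr B A iB iA),
      @IsTensorProd A B A iA iB iA R S X → @IsTensorProd B A B iB iA iB S R Y →
      CorrSSE A iA B iB X Y 1
  | step : ∀ {A : Type} {iA : NonUnitalCStarAlgebra A}
      {B : Type} {iB : NonUnitalCStarAlgebra B}
      {C : Type} {iC : NonUnitalCStarAlgebra C}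
      {X : @Corr A A iA iA} {Y : @Corr B B iB iB} {Z : @Corr C C iC iC} {m : ℕ},
      CorrSSE A iA B iB X Y m → CorrSSE B iB C iC Y Z 1 →
      CorrSSE A iA C iC X Z (m + 1)

/-- Strong shift equivalence of square matrices over `ℕ` with lag `m`. -/
inductive MatSSE :
    ∀ (V : Type) (_ : Fintype V) (_ : DecidableEq V)
      (W : Type) (_ : Fintype W) (_ : DecidableEq W),
      Matrix V V ℕ → Matrix W W ℕ → ℕ → Prop
  | elementary {V : Type} {fV : Fintype V} {dV : DecidableEq V}
      {W : Type} {fW : Fintype W} {dW : DecidableEq W}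
      (A : Matrix V V ℕ) (B : Matrix W W ℕ)
      (R : Matrix V W ℕ) (S : Matrix W V ℕ)
      (hA : A = R * S) (hB : S * R = B) :
      MatSSE V fV dV W fW dW A B 1
  | step {V : Type} {fV : Fintype V} {dV : DecidableEq V}
      {W : Type} {fW : Fintype W} {dW : DecidableEq W}
      {U : Type} {fU : Fintype U} {dU : DecidableEq U}
      {A : Matrix V V ℕ} {B : Matrix W W ℕ} {C : Matrix U U ℕ} {m : ℕ}
      (h₁ : MatSSE V fV dV W fW dW A B m)
      (h₂ : MatSSE W fW dW U fU dU B C 1) :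
      MatSSE V fV dV U fU dU A C (m + 1)

open Classical
noncomputable section

open scoped InnerProductSpace ComplexConjugate

section CorrBasics
variable {A B : Type} [NonUnitalCStarAlgebra A] [NonUnitalCStarAlgebra B] (R : Corr A B)

lemma Corr.ip_add_left (x y z : R.X) : R.ip (x + y) z = R.ip x z + R.ip y z := by
  rw [← R.ip_star, R.ip_add, star_add, R.ip_star, R.ip_star]

lemma Corr.ip_smul_left (c : ℂ) (x z : R.X) : R.ip (c • x) z = conj c • R.ip x z := by
  rw [← R.ip_star, R.ip_smul, star_smul, R.ip_star]; rfl

lemma Corr.ip_sm_left (x z : R.X) (b : B) : R.ip (R.sm x b) z = star b * R.ip x z := by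
  rw [← R.ip_star, R.ip_sm, star_mul, R.ip_star]

lemma Corr.ip_zero (x : R.X) : R.ip x 0 = 0 := by
  have := R.ip_smul 0 x 0
  simpa using this

lemma Corr.ip_zero_left (x : R.X) : R.ip 0 x = 0 := by
  rw [← R.ip_star, R.ip_zero, star_zero]

lemma Corr.ip_sum {ι : Type} (s : Finset ι) (x : R.X) (y : ι → R.X) :
    R.ip x (∑ i ∈ s, y i) = ∑ i ∈ s, R.ip x (y i) := by
  induction s using Finset.induction_on with
  | empty => simp [R.ip_zero]
  | insert a s ha ih => rw [Finset.sum_insert ha, Finset.sum_insert ha, R.ip_add, ih]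

lemma Corr.ip_sum_left {ι : Type} (s : Finset ι) (x : R.X) (y : ι → R.X) :
    R.ip (∑ i ∈ s, y i) x = ∑ i ∈ s, R.ip (y i) x := by
  rw [← R.ip_star, R.ip_sum, star_sum]
  simp [R.ip_star]

/-- the action of the unitization -/
def Corr.φu (c : Unitization ℂ A) (x : R.X) : R.X := c.fst • x + R.φ c.snd x

lemma Corr.φ_zero' (x : R.X) : R.φ 0 x = 0 := by
  have := R.φ_smul' 0 0 x
  simpa using this

lemma Corr.φu_mul (c d : Unitization ℂ A) (x : R.X) :
    R.φu (c * d) x = R.φu c (R.φu d x) := by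
  simp only [Corr.φu, Unitization.fst_mul, Unitization.snd_mul, R.φ_add', R.φ_add, R.φ_smul,
    R.φ_smul', R.φ_mul, smul_add, mul_smul]
  abel

lemma Corr.φu_adj (c : Unitization ℂ A) (x y : R.X) :
    R.ip (R.φu c x) y = R.ip x (R.φu (star c) y) := by
  simp only [Corr.φu, R.ip_add_left, R.ip_add, R.ip_smul_left, R.ip_smul, R.φ_adj,
    Unitization.fst_star, Unitization.snd_star]
  rfl

lemma Corr.exists_defect (a : A) : ∃ c : Unitization ℂ A, ∀ x y : R.X,
    R.ip (R.φu c x) (R.φu c y)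
      = ((‖a‖ ^ 2 : ℝ) : ℂ) • R.ip x y - R.ip (R.φ a x) (R.φ a y) := by
  have h := CStarAlgebra.star_mul_le_algebraMap_norm_sq (a := (a : Unitization ℂ A))
  rw [← sub_nonneg, CStarAlgebra.nonneg_iff_eq_star_mul_self] at h
  obtain ⟨c, hc⟩ := h
  refine ⟨c, fun x y => ?_⟩
  rw [R.φu_adj, ← R.φu_mul, ← hc, Unitization.norm_inr]
  have h1 : (algebraMap ℝ (Unitization ℂ A) (‖a‖ ^ 2) - star (a : Unitization ℂ A) * a).fst
      = ((‖a‖ ^ 2 : ℝ) : ℂ) := by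
    rw [← Unitization.inr_star, ← Unitization.inr_mul, sub_eq_add_neg, Unitization.fst_add,
      Unitization.fst_neg, Unitization.fst_inr, neg_zero, add_zero]
    rfl
  have h2 : (algebraMap ℝ (Unitization ℂ A) (‖a‖ ^ 2) - star (a : Unitization ℂ A) * a).snd
      = (-1 : ℂ) • (star a * a) := by
    rw [← Unitization.inr_star, ← Unitization.inr_mul, sub_eq_add_neg, Unitization.snd_add,
      Unitization.snd_neg, Unitization.snd_inr]
    have : (algebraMap ℝ (Unitization ℂ A) (‖a‖ ^ 2)).snd = 0 := rfl
    rw [this]; simp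
  rw [Corr.φu, h1, h2, R.ip_add, R.ip_smul, R.φ_smul', R.ip_smul, R.φ_mul, R.φ_adj a]
  simp [sub_eq_add_neg]

end CorrBasics

/-- nondegenerate Hilbert space representations -/
structure HRep (A : Type) [NonUnitalCStarAlgebra A] : Type 1 where
  H : Type
  [grp : NormedAddCommGroup H]
  [ips : InnerProductSpace ℂ H]
  [cpl : CompleteSpace H]
  π : A →⋆ₙₐ[ℂ] (H →L[ℂ] H)
  nd : ∀ h, (∀ a, π a h = 0) → h = 0

attribute [instance] HRep.grp HRep.ips HRep.cpl

section Pos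
variable {A B : Type} [NonUnitalCStarAlgebra A] [NonUnitalCStarAlgebra B] (R : Corr A B)

lemma HRep.star_left (H : HRep B) (b : B) (x y : H.H) : ⟪H.π b x, y⟫_ℂ = ⟪x, H.π (star b) y⟫_ℂ := by
  rw [map_star, ContinuousLinearMap.star_eq_adjoint, ContinuousLinearMap.adjoint_inner_right]

lemma HRep.star_right (H : HRep B) (b : B) (x y : H.H) : ⟪x, H.π b y⟫_ℂ = ⟪H.π (star b) x, y⟫_ℂ := by
  rw [H.star_left, star_star]

lemma HRep.mul_apply (H : HRep B) (b c : B) (x : H.H) : H.π (b * c) x = H.π b (H.π c x) := by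
  rw [map_mul]; rfl

lemma HRep.norm_le (H : HRep B) (b : B) : ‖H.π b‖ ≤ ‖b‖ := NonUnitalStarAlgHom.norm_apply_le _ _

variable (H : HRep B)

def QQ {ι : Type} (s : Finset ι) (r : ι → R.X) (h : ι → H.H) : ℂ :=
  ∑ i ∈ s, ∑ j ∈ s, ⟪h i, H.π (R.ip (r i) (r j)) (h j)⟫_ℂ

lemma QQ_single_nonneg (r : R.X) (h : H.H) : 0 ≤ (⟪h, H.π (R.ip r r) h⟫_ℂ).re := by
  obtain ⟨b, hb⟩ := R.ip_pos r
  rw [hb, H.mul_apply, H.star_right, star_star]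
  exact inner_self_nonneg (𝕜 := ℂ)

lemma QQ_cyclic {ι : Type} (s : Finset ι) (r : ι → R.X) (h : ι → H.H) (g : H.H) (a : ι → B)
    (c : ι → ℂ) (hh : ∀ i ∈ s, h i = H.π (a i) g + c i • g) : 0 ≤ (QQ R H s r h).re := by
  have : QQ R H s r h = ⟪g, H.π (R.ip (∑ i ∈ s, (R.sm (r i) (a i) + c i • r i))
      (∑ i ∈ s, (R.sm (r i) (a i) + c i • r i))) g⟫_ℂ := by
    rw [R.ip_sum_left, map_sum, sum_apply, inner_sum, QQ]
    refine Finset.sum_congr rfl fun i hi => ?_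
    rw [R.ip_sum, map_sum, sum_apply, inner_sum]
    refine Finset.sum_congr rfl fun j hj => ?_
    rw [hh i hi, hh j hj]
    simp only [R.ip_add, R.ip_add_left, R.ip_sm, R.ip_sm_left, R.ip_smul, R.ip_smul_left, map_add,
      map_smul, inner_add_left, inner_add_right, inner_smul_left, inner_smul_right,
      add_apply, smul_apply, H.mul_apply,
      smul_mul_assoc, mul_smul_comm]
    rw [H.star_right (star (a i)), star_star, H.star_right (star (a i)), star_star]
    ring
  rw [this]
  exact QQ_single_nonneg R H _ _

def QPos (T : Set H.H) : Prop :=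
  ∀ (ι : Type) (s : Finset ι) (r : ι → R.X) (h : ι → H.H), (∀ i, h i ∈ T) → 0 ≤ (QQ R H s r h).re

lemma QPos_closure {T : Set H.H} (hT : QPos R H T) : QPos R H (closure T) := by
  intro ι s r h hh
  have h1 : h ∈ closure (Set.pi Set.univ fun _ : ι => T) := by
    rw [closure_pi_set]; exact fun i _ => hh i
  have h2 : IsClosed {h : ι → H.H | 0 ≤ (QQ R H s r h).re} := by
    refine isClosed_le continuous_const ?_
    unfold QQ
    refine Complex.continuous_re.comp ?_
    fun_prop
  have h3 : (Set.pi Set.univ fun _ : ι => T) ⊆ {h : ι → H.H | 0 ≤ (QQ R H s r h).re} :=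
    fun k hk => hT ι s r k fun i => hk i (Set.mem_univ _)
  exact closure_minimal h3 h2 h1

/-- `{b g + c g}` -/
def cyc (g : H.H) : Submodule ℂ H.H where
  carrier := {x | ∃ (a : B) (c : ℂ), x = H.π a g + c • g}
  add_mem' := by
    rintro _ _ ⟨a, c, rfl⟩ ⟨a', c', rfl⟩
    refine ⟨a + a', c + c', ?_⟩
    rw [map_add, add_smul, add_apply]; abel
  zero_mem' := ⟨0, 0, by simp⟩
  smul_mem' := by
    rintro t _ ⟨a, c, rfl⟩
    exact ⟨t • a, t * c, by rw [map_smul, smul_add, mul_smul]; rfl⟩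

lemma orth_inv (K : Submodule ℂ H.H) (hK : ∀ b, ∀ x ∈ K, H.π b x ∈ K) (b : B) (x : H.H)
    (hx : x ∈ Kᗮ) : H.π b x ∈ Kᗮ := by
  rw [Submodule.mem_orthogonal] at hx ⊢
  intro u hu
  rw [H.star_right]
  exact hx _ (hK _ _ hu)

lemma exists_QPos (F : Finset H.H) : ∃ K : Submodule ℂ H.H, IsClosed (K : Set H.H) ∧
    (∀ b, ∀ x ∈ K, H.π b x ∈ K) ∧ (∀ x ∈ F, x ∈ K) ∧ QPos R H K := by
  induction F using Finset.induction_on with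
  | empty =>
    refine ⟨⊥, isClosed_singleton, ?_, by simp, ?_⟩
    · rintro b x hx
      rw [Submodule.mem_bot] at hx ⊢
      simp [hx]
    · intro ι s r h hh
      have : ∀ i, h i = 0 := fun i => by simpa using hh i
      simp [QQ, this]
  | insert g F _ ih =>
    obtain ⟨K, hKc, hKi, hKF, hKp⟩ := ih
    have : CompleteSpace K := hKc.completeSpace_coe
    obtain ⟨k, hk, g', hg', rfl⟩ := K.exists_add_mem_mem_orthogonal g
    have hC : cyc H g' ≤ Kᗮ := by
      rintro _ ⟨a, c, rfl⟩
      exact Kᗮ.add_mem (orth_inv H K hKi _ _ hg') (Kᗮ.smul_mem _ hg')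
    have hCi : ∀ b, ∀ x ∈ cyc H g', H.π b x ∈ cyc H g' := by
      rintro b _ ⟨a, c, rfl⟩
      refine ⟨b * a + c • b, 0, ?_⟩
      simp [H.mul_apply]
    refine ⟨(K ⊔ cyc H g').topologicalClosure, Submodule.isClosed_topologicalClosure _, ?_, ?_, ?_⟩
    · intro b x hx
      refine map_mem_closure (H.π b).continuous hx ?_
      intro y hy
      obtain ⟨u, hu, v, hv, rfl⟩ := Submodule.mem_sup.1 hy
      rw [map_add]
      exact Submodule.add_mem_sup (hKi _ _ hu) (hCi _ _ hv)
    · intro x hx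
      apply Submodule.le_topologicalClosure
      rcases Finset.mem_insert.1 hx with rfl | hx
      · exact Submodule.add_mem_sup hk ⟨0, 1, by simp⟩
      · exact Submodule.mem_sup_left (hKF _ hx)
    · rw [Submodule.topologicalClosure_coe]
      apply QPos_closure
      intro ι s r h hh
      choose u hu v hv huv using fun i => Submodule.mem_sup.1 (hh i)
      have e : QQ R H s r h = QQ R H s r u + QQ R H s r v := by
        unfold QQ
        rw [← Finset.sum_add_distrib]
        refine Finset.sum_congr rfl fun i _ => ?_
        rw [← Finset.sum_add_distrib]
        refine Finset.sum_congr rfl fun j _ => ?_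
        rw [← huv i, ← huv j, map_add, inner_add_left, inner_add_right, inner_add_right]
        rw [Submodule.inner_right_of_mem_orthogonal (hu i) (orth_inv H K hKi _ _ (hC (hv j))),
          Submodule.inner_left_of_mem_orthogonal (hKi _ _ (hu j)) (hC (hv i))]
        ring
      rw [e, Complex.add_re]
      refine add_nonneg (hKp ι s r u hu) ?_
      choose a c hac using hv
      exact QQ_cyclic R H s r v g' a c fun i _ => hac i

lemma QQ_nonneg {ι : Type} (s : Finset ι) (r : ι → R.X) (h : ι → H.H) :
    0 ≤ (QQ R H s r h).re := by
  obtain ⟨K, -, -, hF, hp⟩ := exists_QPos R H (s.image h)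
  have := hp ι s r (fun i => if i ∈ s then h i else 0) (fun i => by
    by_cases hi : i ∈ s
    · simpa [hi] using hF _ (Finset.mem_image_of_mem _ hi)
    · simp [hi])
  convert this using 2
  unfold QQ
  refine Finset.sum_congr rfl fun i hi => Finset.sum_congr rfl fun j hj => ?_
  simp [hi, hj]

end Pos
end

open Classical
noncomputable section
open scoped InnerProductSpace ComplexConjugate

section Ext
variable {ι E F : Type} [NormedAddCommGroup E] [InnerProductSpace ℂ E] [CompleteSpace E]
  [NormedAddCommGroup F] [InnerProductSpace ℂ F] [CompleteSpace F]

/-- total families -/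
def Tot (f : ι → E) : Prop := ∀ z, (∀ i, ⟪f i, z⟫_ℂ = 0) → z = 0

lemma Tot.dense {f : ι → E} (hf : Tot f) :
    DenseRange (Finsupp.linearCombination ℂ f) := by
  have h1 : (Submodule.span ℂ (Set.range f))ᗮ = ⊥ := by
    rw [Submodule.eq_bot_iff]
    intro z hz
    exact hf z fun i => hz _ (Submodule.subset_span ⟨i, rfl⟩)
  rw [← Submodule.topologicalClosure_eq_top_iff] at h1
  rw [DenseRange, ← LinearMap.coe_range, Finsupp.range_linearCombination]
  exact Submodule.dense_iff_topologicalClosure_eq_top.2 h1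

lemma Tot.exists_clm {f : ι → E} (hf : Tot f) (g : ι → F) (C : ℝ)
    (h : ∀ c : ι →₀ ℂ, ‖Finsupp.linearCombination ℂ g c‖ ≤ C * ‖Finsupp.linearCombination ℂ f c‖) :
    ∃ T : E →L[ℂ] F, ∀ i, T (f i) = g i := by
  refine ⟨(Finsupp.linearCombination ℂ g).extendOfNorm (Finsupp.linearCombination ℂ f), fun i => ?_⟩
  have := LinearMap.extendOfNorm_eq hf.dense ⟨C, h⟩ (Finsupp.single i 1)
  simpa using this

lemma Tot.clm_ext {f : ι → E} (hf : Tot f) {S T : E →L[ℂ] F} (h : ∀ i, S (f i) = T (f i)) :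
    S = T := by
  have := hf.dense.equalizer S.continuous T.continuous (by
    ext c
    simp only [Function.comp, Finsupp.linearCombination_apply, Finsupp.sum, map_sum, map_smul, h])
  exact DFunLike.coe_injective this

lemma inner_lc {f : ι → E} (c : ι →₀ ℂ) : ⟪Finsupp.linearCombination ℂ f c,
    Finsupp.linearCombination ℂ f c⟫_ℂ = ∑ i ∈ c.support, ∑ j ∈ c.support,
      conj (c i) * (c j * ⟪f i, f j⟫_ℂ) := by
  simp only [Finsupp.linearCombination_apply, Finsupp.sum]
  rw [sum_inner]
  refine Finset.sum_congr rfl fun i _ => ?_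
  rw [inner_sum]
  refine Finset.sum_congr rfl fun j _ => ?_
  rw [inner_smul_left, inner_smul_right]

lemma Tot.exists_isometry {f : ι → E} (hf : Tot f) (g : ι → F)
    (h : ∀ i j, ⟪g i, g j⟫_ℂ = ⟪f i, f j⟫_ℂ) :
    ∃ T : E →ₗᵢ[ℂ] F, ∀ i, T (f i) = g i := by
  have hn : ∀ c : ι →₀ ℂ,
      ‖Finsupp.linearCombination ℂ g c‖ = ‖Finsupp.linearCombination ℂ f c‖ := by
    intro c
    have : ⟪Finsupp.linearCombination ℂ g c, Finsupp.linearCombination ℂ g c⟫_ℂ =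
      ⟪Finsupp.linearCombination ℂ f c, Finsupp.linearCombination ℂ f c⟫_ℂ := by
      rw [inner_lc, inner_lc]; simp only [h]
    rw [inner_self_eq_norm_sq_to_K, inner_self_eq_norm_sq_to_K] at this
    have h2 : ‖Finsupp.linearCombination ℂ g c‖ ^ 2 = ‖Finsupp.linearCombination ℂ f c‖ ^ 2 := by
      exact_mod_cast this
    exact (sq_eq_sq₀ (norm_nonneg _) (norm_nonneg _)).1 h2
  obtain ⟨T, hT⟩ := hf.exists_clm g 1 (fun c => by rw [hn, one_mul])
  have hT' : ∀ c, T (Finsupp.linearCombination ℂ f c) = Finsupp.linearCombination ℂ g c := by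
    intro c
    simp only [Finsupp.linearCombination_apply, Finsupp.sum, map_sum, map_smul, hT]
  refine ⟨⟨T.toLinearMap, fun x => ?_⟩, hT⟩
  refine hf.dense.induction_on (p := fun x => ‖T x‖ = ‖x‖) x
    (isClosed_eq (by fun_prop) (by fun_prop)) (fun c => ?_)
  rw [hT', hn]

end Ext

section Tensor
variable {A B : Type} [NonUnitalCStarAlgebra A] [NonUnitalCStarAlgebra B]

def tk (R : Corr A B) (H : HRep B) : Matrix R.X R.X (H.H →L[ℂ] H.H) :=
  Matrix.of fun r s => H.π (R.ip r s)

open scoped ComplexOrder in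
lemma tk_pos (R : Corr A B) (H : HRep B) : (tk R H).PosSemidef := by
  have key := (RKHS.posSemidef_tfae (K := tk R H)).out 0 2
  refine key.2 ⟨?_, ?_⟩
  · ext r s : 2
    rw [Matrix.conjTranspose_apply]
    simp only [tk, Matrix.of_apply]
    rw [← map_star, R.ip_star]
  · intro vv
    have := QQ_nonneg R H vv.support id vv
    refine this.trans_eq (congrArg Complex.re ?_)
    unfold QQ Finsupp.sum
    refine Finset.sum_congr rfl fun i _ => Finset.sum_congr rfl fun j _ => ?_
    simp only [tk, Matrix.of_apply, id]
    rw [H.star_left, R.ip_star]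

lemma exists_tl {E : Type} [NormedAddCommGroup E] [InnerProductSpace ℂ E]
    (R : Corr A B) (H : HRep B) (t : R.X → H.H →L[ℂ] E)
    (hin : ∀ r r' h h', ⟪t r h, t r' h'⟫_ℂ = ⟪h, H.π (R.ip r r') h'⟫_ℂ)
    (htot : Tot (fun p : R.X × H.H => t p.1 p.2)) :
    ∃ L : H.H → R.X →L[ℂ] E, ∀ h r, L h r = t r h := by
  have hl : ∀ {z w : E}, (∀ r h, ⟪t r h, z⟫_ℂ = ⟪t r h, w⟫_ℂ) → z = w := by
    intro z w h
    rw [← sub_eq_zero]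
    exact htot _ fun p => by rw [inner_sub_right, h, sub_self]
  refine ⟨fun h => LinearMap.mkContinuous (⟨⟨fun r => t r h, fun r r' => ?_⟩, fun c r => ?_⟩ : R.X →ₗ[ℂ] E) ‖h‖ ?_,
    fun h r => rfl⟩
  · apply hl; intro s k
    rw [inner_add_right, hin, hin, hin, R.ip_add, map_add, add_apply, inner_add_right]
  · apply hl; intro s k
    simp only [RingHom.id_apply]
    rw [inner_smul_right, hin, hin, R.ip_smul, map_smul, smul_apply, inner_smul_right]
  · intro r
    have h1 : ‖t r h‖ ^ 2 ≤ (‖h‖ * ‖r‖) ^ 2 := by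
      have h2 : ‖⟪t r h, t r h⟫_ℂ‖ = ‖t r h‖ ^ 2 := by
        rw [inner_self_eq_norm_sq_to_K]; simp
      rw [← h2, hin]
      calc _ ≤ ‖h‖ * ‖H.π (R.ip r r) h‖ := norm_inner_le_norm _ _
        _ ≤ ‖h‖ * (‖R.ip r r‖ * ‖h‖) := by
          gcongr
          exact (H.π (R.ip r r)).le_of_opNorm_le (H.norm_le _) h
        _ = _ := by rw [← R.ip_norm]; ring
    exact (pow_le_pow_iff_left₀ (norm_nonneg _) (by positivity) two_ne_zero).1 h1

lemma exists_tensor (R : Corr A B) (H : HRep B) : ∃ (T : HRep A) (t : R.X → H.H →L[ℂ] T.H),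
    (∀ r r' h h', ⟪t r h, t r' h'⟫_ℂ = ⟪h, H.π (R.ip r r') h'⟫_ℂ) ∧
    (∀ a r h, T.π a (t r h) = t (R.φ a r) h) ∧
    Tot (fun p : R.X × H.H => t p.1 p.2) := by
  have : Fact (tk R H).PosSemidef := ⟨tk_pos R H⟩
  let K := RKHS.OfKernel (tk R H)
  let t : R.X → H.H →L[ℂ] K := fun r => RKHS.kerFun (RKHS.OfKernel (tk R H)) r
  have hin : ∀ r r' h h', ⟪t r h, t r' h'⟫_ℂ = ⟪h, H.π (R.ip r r') h'⟫_ℂ := by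
    intro r r' h h'
    have := RKHS.kernel_inner (RKHS.OfKernel (tk R H)) r' r h h'
    rw [RKHS.OfKernel.kernel_ofKernel] at this
    rw [H.star_right, R.ip_star]
    exact this.symm
  have htot : Tot (fun p : R.X × H.H => t p.1 p.2) := by
    intro z hz
    have hd := RKHS.kerFun_dense (RKHS.OfKernel (tk R H))
    have : z ∈ (Submodule.span ℂ
        {x | ∃ r v, RKHS.kerFun (RKHS.OfKernel (tk R H)) r v = x})ᗮ := by
      rw [Submodule.mem_orthogonal]
      intro u hu
      induction hu using Submodule.span_induction with
      | mem x hx => obtain ⟨r, v, rfl⟩ := hx; exact hz (r, v)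
      | zero => simp
      | add x y _ _ hx hy => rw [inner_add_left, hx, hy, add_zero]
      | smul c x _ hx => rw [inner_smul_left, hx, mul_zero]
    rw [Submodule.topologicalClosure_eq_top_iff] at hd
    rw [hd] at this
    simpa using this
  have key : ∀ a : A, ∃ S : K →L[ℂ] K, ∀ p : R.X × H.H, S (t p.1 p.2) = t (R.φ a p.1) p.2 := by
    intro a
    apply htot.exists_clm _ ‖a‖
    intro c
    obtain ⟨d, hd⟩ := R.exists_defect a
    have hp := QQ_nonneg R H c.support (fun p => R.φu d p.1) (fun p => c p • p.2)
    have e : QQ R H c.support (fun p => R.φu d p.1) (fun p => c p • p.2)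
        = ((‖a‖ ^ 2 : ℝ) : ℂ) * ⟪Finsupp.linearCombination ℂ (fun p : R.X × H.H => t p.1 p.2) c,
            Finsupp.linearCombination ℂ (fun p : R.X × H.H => t p.1 p.2) c⟫_ℂ
          - ⟪Finsupp.linearCombination ℂ (fun p : R.X × H.H => t (R.φ a p.1) p.2) c,
            Finsupp.linearCombination ℂ (fun p : R.X × H.H => t (R.φ a p.1) p.2) c⟫_ℂ := by
      rw [inner_lc, inner_lc, QQ, Finset.mul_sum, ← Finset.sum_sub_distrib]
      refine Finset.sum_congr rfl fun i _ => ?_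
      rw [Finset.mul_sum, ← Finset.sum_sub_distrib]
      refine Finset.sum_congr rfl fun j _ => ?_
      rw [hd, hin, hin, map_sub, sub_apply, map_smul H.π, smul_apply, map_smul,
        map_smul, inner_smul_left, inner_sub_right, inner_smul_right, inner_smul_right,
        inner_smul_right]
      ring
    rw [e, inner_self_eq_norm_sq_to_K, inner_self_eq_norm_sq_to_K] at hp
    have hp' : 0 ≤ ‖a‖ ^ 2 * ‖Finsupp.linearCombination ℂ (fun p : R.X × H.H => t p.1 p.2) c‖ ^ 2
        - ‖Finsupp.linearCombination ℂ (fun p : R.X × H.H => t (R.φ a p.1) p.2) c‖ ^ 2 := by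
      have e2 : ∀ x y z : ℝ, ((x : ℂ) * ((y : ℂ)) ^ 2 - (z : ℂ) ^ 2).re = x * y ^ 2 - z ^ 2 := by
        intro x y z
        rw [← Complex.ofReal_pow, ← Complex.ofReal_pow, ← Complex.ofReal_mul, ← Complex.ofReal_sub,
          Complex.ofReal_re]
      erw [e2] at hp
      exact hp
    rw [← mul_pow] at hp'
    exact (pow_le_pow_iff_left₀ (norm_nonneg _) (by positivity) two_ne_zero).1 (sub_nonneg.1 hp')
  choose P hP using key
  have hP' : ∀ a r h, P a (t r h) = t (R.φ a r) h := fun a r h => hP a (r, h)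
  have hl : ∀ {z w : K}, (∀ r h, ⟪t r h, z⟫_ℂ = ⟪t r h, w⟫_ℂ) → z = w := by
    intro z w h
    rw [← sub_eq_zero]
    exact htot _ fun p => by rw [inner_sub_right, h, sub_self]
  have tadd : ∀ r r' h, t (r + r') h = t r h + t r' h := by
    intro r r' h
    apply hl; intro s k
    rw [inner_add_right, hin, hin, hin, R.ip_add, map_add, add_apply, inner_add_right]
  have tsmul : ∀ (c : ℂ) r h, t (c • r) h = c • t r h := by
    intro c r h
    apply hl; intro s k
    rw [inner_smul_right, hin, hin, R.ip_smul, map_smul, smul_apply, inner_smul_right]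
  let π : A →⋆ₙₐ[ℂ] (K →L[ℂ] K) :=
    { toFun := P
      map_smul' := fun c a => htot.clm_ext fun p => by
        simp only [smul_apply, hP, R.φ_smul', tsmul, MonoidHom.id_apply]
      map_zero' := htot.clm_ext fun p => by
        have := tsmul 0 (R.φ 0 p.1) p.2
        rw [zero_smul, zero_smul] at this
        simp only [hP, R.φ_zero', this, zero_apply]
      map_add' := fun a b => htot.clm_ext fun p => by
        simp only [add_apply, hP, R.φ_add', tadd]
      map_mul' := fun a b => htot.clm_ext fun p => by
        rw [mul_apply_eq_comp]
        simp only [hP', R.φ_mul]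
      map_star' := fun a => htot.clm_ext fun p => by
        apply hl; intro r h
        rw [ContinuousLinearMap.star_eq_adjoint, ContinuousLinearMap.adjoint_inner_right, hP, hP',
          hin, hin, R.φ_adj] }
  refine ⟨⟨K, π, ?_⟩, t, hin, hP', htot⟩
  intro z hz
  apply htot z
  intro p
  -- density of the left action
  have h1 : ∀ a r h, ⟪t (R.φ a r) h, z⟫_ℂ = 0 := by
    intro a r h
    have h2 : P (star a) z = 0 := hz (star a)
    rw [← hP', ← ContinuousLinearMap.adjoint_inner_right, ← ContinuousLinearMap.star_eq_adjoint]
    have : star (P a) = P (star a) := (map_star π a).symm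
    rw [this, h2, inner_zero_right]
  obtain ⟨L, hL⟩ := exists_tl R H t hin htot
  have hc : IsClosed {r : R.X | ⟪L p.2 r, z⟫_ℂ = 0} := isClosed_eq (by fun_prop) continuous_const
  have hs : (Submodule.span ℂ {z | ∃ a x, z = R.φ a x} : Set R.X) ⊆ {r : R.X | ⟪L p.2 r, z⟫_ℂ = 0} := by
    intro u hu
    induction hu using Submodule.span_induction with
    | mem x hx => obtain ⟨a, x, rfl⟩ := hx; simp only [Set.mem_ofPred_eq, hL]; exact h1 a x p.2
    | zero => change ⟪L p.2 0, z⟫_ℂ = 0; rw [map_zero]; exact inner_zero_left _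
    | add x y _ _ hx hy =>
      simp only [Set.mem_ofPred_eq] at hx hy ⊢; rw [map_add, inner_add_left, hx, hy, add_zero]
    | smul c x _ hx =>
      simp only [Set.mem_ofPred_eq] at hx ⊢; rw [map_smul, inner_smul_left, hx, mul_zero]
  have h3 := closure_minimal hs hc
  rw [R.nondeg] at h3
  have := h3 (Set.mem_univ p.1)
  simpa [hL] using this
end Tensor
end

open Classical
noncomputable section
open scoped InnerProductSpace ComplexConjugate

section Emb
variable {A : Type} [NonUnitalCStarAlgebra A]

/-- isometric intertwiners -/
structure Emb (H K : HRep A) where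
  T : H.H →L[ℂ] K.H
  comm : ∀ a x, T (H.π a x) = K.π a (T x)
  iso : ∀ x y, ⟪T x, T y⟫_ℂ = ⟪x, y⟫_ℂ

/-- bounded intertwiners -/
def HHom (H K : HRep A) : Submodule ℂ (H.H →L[ℂ] K.H) where
  carrier := {T | ∀ a x, T (H.π a x) = K.π a (T x)}
  add_mem' := by
    intro S T hS hT a x
    rw [add_apply, add_apply, map_add, hS, hT]
  zero_mem' := by intro a x; simp
  smul_mem' := by
    intro c T hT a x
    rw [smul_apply, smul_apply, map_smul, hT]

lemma HHom.adj {H K : HRep A} {T : H.H →L[ℂ] K.H} (hT : T ∈ HHom H K) :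
    ContinuousLinearMap.adjoint T ∈ HHom K H := by
  intro a x
  refine ext_inner_left ℂ fun v => ?_
  rw [ContinuousLinearMap.adjoint_inner_right, K.star_right, H.star_right,
    ContinuousLinearMap.adjoint_inner_right, hT]

lemma HHom.comp {H K L : HRep A} {S : K.H →L[ℂ] L.H} {T : H.H →L[ℂ] K.H}
    (hS : S ∈ HHom K L) (hT : T ∈ HHom H K) : S ∘L T ∈ HHom H L := by
  intro a x
  simp only [ContinuousLinearMap.comp_apply]
  rw [hT, hS]

lemma Emb.mem {H K : HRep A} (e : Emb H K) : e.T ∈ HHom H K := e.comm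

def Emb.refl (H : HRep A) : Emb H H := ⟨ContinuousLinearMap.id ℂ _, fun _ _ => rfl, fun _ _ => rfl⟩

def Emb.trans {H K L : HRep A} (e : Emb H K) (f : Emb K L) : Emb H L :=
  ⟨f.T ∘L e.T, fun a x => by simp only [ContinuousLinearMap.comp_apply, e.comm, f.comm],
    fun x y => by simp only [ContinuousLinearMap.comp_apply, f.iso, e.iso]⟩

lemma Emb.adj_T {H K : HRep A} (e : Emb H K) (x : H.H) :
    ContinuousLinearMap.adjoint e.T (e.T x) = x :=
  ext_inner_left ℂ fun v => by rw [ContinuousLinearMap.adjoint_inner_right, e.iso]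

lemma Emb.inj {H K : HRep A} (e : Emb H K) : Function.Injective e.T :=
  Function.LeftInverse.injective e.adj_T

lemma Emb.closed {H K : HRep A} (e : Emb H K) : IsClosed (Set.range e.T) := by
  have : Isometry e.T := by
    refine AddMonoidHomClass.isometry_of_norm e.T fun x => ?_
    have := e.iso x x
    rw [inner_self_eq_norm_sq_to_K, inner_self_eq_norm_sq_to_K] at this
    have h2 : ‖e.T x‖ ^ 2 = ‖x‖ ^ 2 := by exact_mod_cast this
    exact (sq_eq_sq₀ (norm_nonneg _) (norm_nonneg _)).1 h2
  exact this.isClosedEmbedding.isClosed_range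

def HIso (H K : HRep A) : Prop := ∃ e : Emb H K, Function.Surjective e.T

lemma HIso.refl (H : HRep A) : HIso H H := ⟨Emb.refl H, fun x => ⟨x, rfl⟩⟩

lemma HIso.trans {H K L : HRep A} : HIso H K → HIso K L → HIso H L := by
  rintro ⟨e, he⟩ ⟨f, hf⟩
  exact ⟨e.trans f, hf.comp he⟩

lemma HIso.symm {H K : HRep A} : HIso H K → HIso K H := by
  rintro ⟨e, he⟩
  refine ⟨⟨ContinuousLinearMap.adjoint e.T, HHom.adj e.mem, fun x y => ?_⟩, fun x => ⟨e.T x, e.adj_T x⟩⟩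
  obtain ⟨x, rfl⟩ := he x
  obtain ⟨y, rfl⟩ := he y
  rw [e.adj_T, e.adj_T, e.iso]

/-- closed invariant subspaces -/
structure SubR (H : HRep A) where
  K : Submodule ℂ H.H
  cl : IsClosed (K : Set H.H)
  inv : ∀ a, ∀ x ∈ K, H.π a x ∈ K

def SubR.rep {H : HRep A} (S : SubR H) : HRep A :=
  letI : CompleteSpace S.K := S.cl.completeSpace_coe
  { H := S.K
    π :=
    { toFun := fun a => ((H.π a) ∘L S.K.subtypeL).codRestrict S.K fun x => S.inv a x x.2
      map_smul' := fun c a => by ext x; simp; rfl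
      map_zero' := by ext x; simp
      map_add' := fun a b => by ext x; simp; rfl
      map_mul' := fun a b => by ext x; simp; rfl
      map_star' := fun a => by
        ext1 x
        refine ext_inner_left ℂ fun v => ?_
        rw [ContinuousLinearMap.star_eq_adjoint, ContinuousLinearMap.adjoint_inner_right]
        change ⟪(v : H.H), H.π (star a) x⟫_ℂ = ⟪H.π a (v : H.H), (x : H.H)⟫_ℂ
        rw [H.star_left] }
    nd := fun x hx => Subtype.ext (H.nd x fun a => congrArg Subtype.val (hx a)) }

def SubR.inc {H : HRep A} (S : SubR H) : Emb S.rep H :=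
  ⟨S.K.subtypeL, fun _ _ => rfl, fun _ _ => rfl⟩

lemma SubR.inc_mem {H : HRep A} (S : SubR H) (x) : S.inc.T x ∈ S.K := by
  exact Subtype.property (p := (· ∈ S.K)) x

lemma SubR.exists_inc {H : HRep A} (S : SubR H) {x} (hx : x ∈ S.K) : ∃ y, S.inc.T y = x :=
  ⟨(⟨x, hx⟩ : S.K), rfl⟩

def SubR.compl {H : HRep A} (S : SubR H) : SubR H :=
  ⟨S.Kᗮ, Submodule.isClosed_orthogonal _, fun a x hx => orth_inv H S.K S.inv a x hx⟩

def Emb.rng {H K : HRep A} (e : Emb H K) : SubR K where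
  K := LinearMap.range e.T.toLinearMap
  cl := e.closed
  inv := by
    rintro a _ ⟨x, rfl⟩
    exact ⟨H.π a x, e.comm a x⟩

lemma SubR.lift {H L : HRep A} (S : SubR H) (e : Emb L H) (h : ∀ x, e.T x ∈ S.K) :
    ∃ f : Emb L S.rep, ∀ x, S.inc.T (f.T x) = e.T x :=
  ⟨⟨e.T.codRestrict S.K h, fun a x => Subtype.ext (e.comm a x), fun x y => e.iso x y⟩, fun _ => rfl⟩

/-- orthogonal splittings -/
def Spl (H H₁ H₂ : HRep A) : Prop := ∃ (e : Emb H₁ H) (f : Emb H₂ H),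
  (∀ x y, ⟪e.T x, f.T y⟫_ℂ = 0) ∧
  ∀ z, (∀ x, ⟪e.T x, z⟫_ℂ = 0) → (∀ y, ⟪f.T y, z⟫_ℂ = 0) → z = 0

lemma SubR.spl {H : HRep A} (S : SubR H) : Spl H S.rep S.compl.rep := by
  refine ⟨S.inc, S.compl.inc, fun x y => ?_, fun z hz hz' => ?_⟩
  · exact (S.K.mem_orthogonal _).1 (S.compl.inc_mem y) _ (S.inc_mem x)
  · have h1 : z ∈ S.Kᗮ := by
      rw [S.K.mem_orthogonal]
      intro u hu
      obtain ⟨y, rfl⟩ := S.exists_inc hu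
      exact hz y
    obtain ⟨y, hy⟩ := S.compl.exists_inc h1
    have := hz' y
    rw [hy] at this
    simpa using this

lemma Spl.emb_left {H H₁ H₂ : HRep A} (h : Spl H H₁ H₂) : Nonempty (Emb H₁ H) := ⟨h.choose⟩
lemma Spl.emb_right {H H₁ H₂ : HRep A} (h : Spl H H₁ H₂) : Nonempty (Emb H₂ H) :=
  ⟨h.choose_spec.choose⟩

lemma Spl.of_iso {H K H₁ H₂ : HRep A} (h : Spl H H₁ H₂) (hi : HIso H K) : Spl K H₁ H₂ := by
  obtain ⟨e, f, h1, h2⟩ := h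
  obtain ⟨i, hi⟩ := hi
  refine ⟨e.trans i, f.trans i, fun x y => ?_, fun z hz hz' => ?_⟩
  · exact (i.iso _ _).trans (h1 x y)
  · obtain ⟨z, rfl⟩ := hi z
    rw [h2 z, map_zero]
    · intro x; rw [← i.iso]; exact hz x
    · intro x; rw [← i.iso]; exact hz' x

/-- the resolution of identity of a splitting -/
lemma Spl.res {H H₁ H₂ : HRep A} {e : Emb H₁ H} {f : Emb H₂ H}
    (h1 : ∀ x y, ⟪e.T x, f.T y⟫_ℂ = 0)
    (h2 : ∀ z, (∀ x, ⟪e.T x, z⟫_ℂ = 0) → (∀ y, ⟪f.T y, z⟫_ℂ = 0) → z = 0) (z : H.H) :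
    z = e.T (ContinuousLinearMap.adjoint e.T z) + f.T (ContinuousLinearMap.adjoint f.T z) := by
  rw [← sub_eq_zero]
  apply h2
  · intro x
    rw [inner_sub_right, inner_add_right, h1, e.iso, ContinuousLinearMap.adjoint_inner_right]
    ring
  · intro x
    have h1' : ∀ x y, ⟪f.T x, e.T y⟫_ℂ = 0 := fun x y => by rw [← inner_conj_symm, h1, map_zero]
    rw [inner_sub_right, inner_add_right, f.iso, ContinuousLinearMap.adjoint_inner_right, h1']
    ring

lemma Spl.adj_zero {H H₁ H₂ : HRep A} {e : Emb H₁ H} {f : Emb H₂ H}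
    (h1 : ∀ x y, ⟪e.T x, f.T y⟫_ℂ = 0) (y) : ContinuousLinearMap.adjoint e.T (f.T y) = 0 :=
  ext_inner_left ℂ fun v => by rw [ContinuousLinearMap.adjoint_inner_right, h1, inner_zero_right]

lemma Spl.swap {H H₁ H₂ : HRep A} (h : Spl H H₁ H₂) : Spl H H₂ H₁ := by
  obtain ⟨e, f, h1, h2⟩ := h
  exact ⟨f, e, fun x y => by rw [← inner_conj_symm, h1, map_zero], fun z a b => h2 z b a⟩

def HZero (H : HRep A) : Prop := ∀ h : H.H, h = 0

def zrep (A : Type) [NonUnitalCStarAlgebra A] : HRep A where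
  H := EuclideanSpace ℂ (Fin 0)
  π := 0
  nd := fun _ _ => Subsingleton.elim _ _

lemma zrep_zero : HZero (zrep A) := fun h => by
  have : Subsingleton (EuclideanSpace ℂ (Fin 0)) := inferInstance
  exact this.elim h 0

def zemb (H : HRep A) : Emb (zrep A) H :=
  ⟨0, fun a x => by simp, fun x y => by simp [zrep_zero x]⟩

lemma HIso.spl {H K : HRep A} (h : HIso K H) : Spl H K (zrep A) := by
  obtain ⟨e, he⟩ := h
  refine ⟨e, zemb H, fun x y => by simp [zemb], fun z hz _ => ?_⟩
  obtain ⟨x, rfl⟩ := he z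
  have := hz x
  simpa using this

lemma HZero.iso {H K : HRep A} (h : HZero H) (hi : HIso H K) : HZero K := by
  obtain ⟨e, he⟩ := hi
  intro y
  obtain ⟨x, rfl⟩ := he y
  rw [h x, map_zero]

end Emb

section hd
variable {A : Type} [NonUnitalCStarAlgebra A]

def hd (ρ H : HRep A) : ℕ∞ := Cardinal.toENat (Module.rank ℂ (HHom ρ H))

lemma hd_spl (ρ : HRep A) {H H₁ H₂ : HRep A} (h : Spl H H₁ H₂) : hd ρ H = hd ρ H₁ + hd ρ H₂ := by
  obtain ⟨e, f, h1, h2⟩ := h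
  have h1' : ∀ x y, ⟪f.T x, e.T y⟫_ℂ = 0 := fun x y => by rw [← inner_conj_symm, h1, map_zero]
  let Φ : HHom ρ H ≃ₗ[ℂ] HHom ρ H₁ × HHom ρ H₂ :=
    { toFun := fun T => (⟨_, HHom.comp (HHom.adj e.mem) T.2⟩, ⟨_, HHom.comp (HHom.adj f.mem) T.2⟩)
      map_add' := fun S T => by
        refine Prod.ext (Subtype.ext ?_) (Subtype.ext ?_) <;> ext x <;> simp
      map_smul' := fun c T => by
        refine Prod.ext (Subtype.ext ?_) (Subtype.ext ?_) <;> ext x <;> simp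
      invFun := fun p => ⟨e.T ∘L p.1.1 + f.T ∘L p.2.1,
        Submodule.add_mem _ (HHom.comp e.mem p.1.2) (HHom.comp f.mem p.2.2)⟩
      left_inv := fun T => by
        ext x
        exact (Spl.res h1 h2 (T.1 x)).symm
      right_inv := fun p => by
        refine Prod.ext (Subtype.ext ?_) (Subtype.ext ?_) <;> ext x <;>
          simp [e.adj_T, f.adj_T, Spl.adj_zero h1, Spl.adj_zero h1'] }
  unfold hd
  rw [Φ.rank_eq, rank_prod', map_add]

lemma hd_zero {ρ H : HRep A} (h : ∀ T ∈ HHom ρ H, T = 0) : hd ρ H = 0 := by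
  have : Subsingleton (HHom ρ H) := ⟨fun S T => Subtype.ext (by rw [h _ S.2, h _ T.2])⟩
  unfold hd
  rw [rank_subsingleton']
  simp

lemma hd_HZero {ρ H : HRep A} (h : HZero H) : hd ρ H = 0 :=
  hd_zero fun T _ => by ext x; rw [h (T x)]; rfl

lemma hd_iso (ρ : HRep A) {H K : HRep A} (h : HIso H K) : hd ρ H = hd ρ K := by
  rw [hd_spl ρ h.spl, hd_HZero zrep_zero, add_zero]

lemma hd_ne {ρ H : HRep A} (h : hd ρ H ≠ 0) : ∃ T ∈ HHom ρ H, T ≠ 0 := by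
  by_contra hc
  push Not at hc
  exact h (hd_zero hc)
end hd

section irr
variable {A : Type} [NonUnitalCStarAlgebra A]

def Irr (ρ : HRep A) : Prop := ¬ HZero ρ ∧ ∀ S : SubR ρ, S.K = ⊥ ∨ S.K = ⊤

def kerS {H K : HRep A} {T : H.H →L[ℂ] K.H} (hT : T ∈ HHom H K) : SubR H where
  K := LinearMap.ker T.toLinearMap
  cl := T.isClosed_ker
  inv := fun a x hx => by
    have hx' : T x = 0 := hx
    change T _ = 0
    rw [hT, hx', map_zero]

lemma Irr.mul_zero {ρ : HRep A} (h : Irr ρ) {S T : ρ.H →L[ℂ] ρ.H} (hS : S ∈ HHom ρ ρ)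
    (hST : S * T = 0) : S = 0 ∨ T = 0 := by
  rcases h.2 (kerS hS) with h1 | h1
  · right
    ext x
    have : T x ∈ (kerS hS).K := by
      change S (T x) = 0
      exact congrArg (fun U : ρ.H →L[ℂ] ρ.H => U x) hST
    rw [h1] at this
    simpa using this
  · left
    ext x
    have : x ∈ (kerS hS).K := by rw [h1]; trivial
    exact this

lemma Irr.schur_sa {ρ : HRep A} (h : Irr ρ) {T : ρ.H →L[ℂ] ρ.H} (hT : T ∈ HHom ρ ρ)
    (hs : IsSelfAdjoint T) : ∃ c : ℂ, T = c • 1 := by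
  have hcomm : ∀ f : ℝ → ℝ, cfc f T ∈ HHom ρ ρ := by
    intro f a x
    have h1 : Commute T (ρ.π a) := by
      ext y; exact hT a y
    have h2 : Commute (cfc f T) (ρ.π a) := h1.cfc_real f
    exact congrArg (fun U : ρ.H →L[ℂ] ρ.H => U x) h2
  obtain ⟨x0, hx0⟩ : ∃ x : ρ.H, x ≠ 0 := by
    by_contra hc
    push Not at hc
    exact h.1 hc
  have : Nontrivial ρ.H := ⟨⟨x0, 0, hx0⟩⟩
  have hne : (spectrum ℝ T).Nonempty := ContinuousFunctionalCalculus.spectrum_nonempty T hs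
  obtain ⟨a, ha⟩ := hne
  have huniq : ∀ b ∈ spectrum ℝ T, b = a := by
    have key : ∀ a b, a ∈ spectrum ℝ T → b ∈ spectrum ℝ T → a < b → False := by
      intro a b ha hb hab
      let f : ℝ → ℝ := fun x => max ((a + b) / 2 - x) 0
      let g : ℝ → ℝ := fun x => max (x - (a + b) / 2) 0
      have hf : Continuous f := by fun_prop
      have hg : Continuous g := by fun_prop
      have hfg : cfc f T * cfc g T = 0 := by
        rw [← cfc_mul f g T hf.continuousOn hg.continuousOn]
        have : (fun x => f x * g x) = fun _ => 0 := by
          ext x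
          rcases le_total x ((a + b) / 2) with hx | hx
          · simp [g, max_eq_right (sub_nonpos.2 hx)]
          · simp [f, max_eq_right (sub_nonpos.2 hx)]
        rw [this, cfc_const_zero]
      have nz : ∀ (k : ℝ → ℝ), Continuous k → ∀ c ∈ spectrum ℝ T, k c ≠ 0 → cfc k T ≠ 0 := by
        intro k hk c hc hkc h0
        have h3 : k c ∈ spectrum ℝ (cfc k T) := by
          rw [cfc_map_spectrum k T hs hk.continuousOn]; exact ⟨c, hc, rfl⟩
        rw [h0, spectrum.zero_eq] at h3
        exact hkc h3
      rcases h.mul_zero (hcomm f) hfg with h1 | h1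
      · refine nz f hf a ha ?_ h1
        have : 0 < f a := lt_max_of_lt_left (by linarith)
        exact this.ne'
      · refine nz g hg b hb ?_ h1
        have : 0 < g b := lt_max_of_lt_left (by linarith)
        exact this.ne'
    intro b hb
    rcases lt_trichotomy a b with h1 | h1 | h1
    · exact (key a b ha hb h1).elim
    · exact h1.symm
    · exact (key b a hb ha h1).elim
  refine ⟨(a : ℂ), ?_⟩
  have h4 : cfc (fun x : ℝ => x) T = cfc (fun _ : ℝ => a) T :=
    cfc_congr fun b hb => huniq b hb
  rw [cfc_id' ℝ T hs, cfc_const a T hs] at h4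
  rw [h4]
  ext x
  rfl

lemma Irr.schur {ρ : HRep A} (h : Irr ρ) {T : ρ.H →L[ℂ] ρ.H} (hT : T ∈ HHom ρ ρ) :
    ∃ c : ℂ, T = c • 1 := by
  have hT' : star T ∈ HHom ρ ρ := HHom.adj hT
  obtain ⟨c, hc⟩ := h.schur_sa (T := T + star T) (Submodule.add_mem _ hT hT')
    (IsSelfAdjoint.add_star_self T)
  obtain ⟨d, hd⟩ := h.schur_sa (T := Complex.I • (T - star T))
    (Submodule.smul_mem _ _ (Submodule.sub_mem _ hT hT')) (by
      rw [isSelfAdjoint_iff, star_smul, star_sub, star_star]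
      simp [smul_sub]
      abel)
  refine ⟨(1 / 2 : ℂ) * (c - Complex.I * d), ?_⟩
  have e : T = (1 / 2 : ℂ) • ((T + star T) - Complex.I • (Complex.I • (T - star T))) := by
    rw [smul_smul, Complex.I_mul_I, neg_smul, one_smul, sub_neg_eq_add, add_add_sub_cancel,
      ← two_smul ℂ T, smul_smul]
    norm_num
  rw [e, hc, hd, smul_smul, ← sub_smul, smul_smul]

lemma Irr.emb {ρ H : HRep A} (h : Irr ρ) {T : ρ.H →L[ℂ] H.H} (hT : T ∈ HHom ρ H) (hne : T ≠ 0) :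
    ∃ (e : Emb ρ H) (c : ℂ), c ≠ 0 ∧ T = c • e.T := by
  obtain ⟨c, hc⟩ := h.schur (HHom.comp (HHom.adj hT) hT)
  have hc' : ∀ x y, ⟪T x, T y⟫_ℂ = c * ⟪x, y⟫_ℂ := by
    intro x y
    rw [← ContinuousLinearMap.adjoint_inner_right, ← ContinuousLinearMap.comp_apply, hc,
      smul_apply, inner_smul_right]
    rfl
  obtain ⟨x, hx⟩ : ∃ x, T x ≠ 0 := by
    by_contra hcon
    push Not at hcon
    exact hne (by ext x; exact hcon x)
  have hx0 : x ≠ 0 := by rintro rfl; simp at hx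
  have h1 := hc' x x
  rw [inner_self_eq_norm_sq_to_K, inner_self_eq_norm_sq_to_K] at h1
  have hp : 0 < ‖T x‖ / ‖x‖ := div_pos (norm_pos_iff.2 hx) (norm_pos_iff.2 hx0)
  have hcr : c = (((‖T x‖ / ‖x‖) ^ 2 : ℝ) : ℂ) := by
    have hxn : ((‖x‖ : ℝ) : ℂ) ≠ 0 := by exact_mod_cast (norm_pos_iff.2 hx0).ne'
    push_cast
    rw [div_pow, eq_div_iff (pow_ne_zero 2 hxn)]
    exact h1.symm
  set k := ‖T x‖ / ‖x‖
  have hk : ((k : ℝ) : ℂ) ≠ 0 := by exact_mod_cast hp.ne'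
  refine ⟨⟨((k : ℂ)⁻¹) • T, Submodule.smul_mem _ _ hT, fun y z => ?_⟩, k, hk, ?_⟩
  · rw [smul_apply, smul_apply, inner_smul_left, inner_smul_right, hc', hcr, map_inv₀,
      Complex.conj_ofReal]
    push_cast
    field_simp
  · rw [smul_smul, mul_inv_cancel₀ hk, one_smul]

lemma Irr.surj {ρ H : HRep A} (hH : Irr H) (h : ¬ HZero ρ) (e : Emb ρ H) : HIso ρ H := by
  refine ⟨e, fun y => ?_⟩
  rcases hH.2 e.rng with h1 | h1
  · exfalso
    apply h
    intro x
    have : e.T x ∈ e.rng.K := ⟨x, rfl⟩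
    rw [h1] at this
    have h2 : e.T x = 0 := by simpa using this
    rw [← e.adj_T x, h2, map_zero]
  · have : y ∈ e.rng.K := by rw [h1]; trivial
    exact this

lemma Irr.iso_of_hom {ρ H : HRep A} (h : Irr ρ) (hH : Irr H) {T : ρ.H →L[ℂ] H.H} (hT : T ∈ HHom ρ H)
    (hne : T ≠ 0) : HIso ρ H := by
  obtain ⟨e, -⟩ := h.emb hT hne
  exact hH.surj h.1 e

lemma Irr.hd_one {ρ H : HRep A} (h : Irr ρ) (hi : HIso ρ H) : hd ρ H = 1 := by
  rw [hd_iso ρ hi.symm]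
  have : Module.finrank ℂ (HHom ρ ρ) = 1 := by
    refine finrank_eq_one (⟨1, (Emb.refl ρ).mem⟩ : HHom ρ ρ) ?_ ?_
    · intro h0
      have h1 : (1 : ρ.H →L[ℂ] ρ.H) = 0 := congrArg Subtype.val h0
      exact h.1 fun x => congrArg (fun U : ρ.H →L[ℂ] ρ.H => U x) h1
    · rintro ⟨T, hT⟩
      obtain ⟨c, rfl⟩ := h.schur hT
      exact ⟨c, rfl⟩
  have h2 : Module.rank ℂ (HHom ρ ρ) = 1 := Module.rank_eq_one_iff_finrank_eq_one.2 this
  unfold hd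
  rw [h2]
  simp

lemma Irr.hd_zero {ρ H : HRep A} (h : Irr ρ) (hH : Irr H) (hi : ¬ HIso ρ H) : hd ρ H = 0 :=
  _root_.hd_zero fun T hT => by
    by_contra hne
    exact hi (h.iso_of_hom hH hT hne)

lemma Irr.of_iso {ρ H : HRep A} (h : Irr ρ) (hi : HIso ρ H) : Irr H := by
  obtain ⟨e, he⟩ := hi
  refine ⟨fun hz => h.1 (hz.iso (HIso.symm ⟨e, he⟩)), fun S => ?_⟩
  let S' : SubR ρ := ⟨S.K.comap e.T.toLinearMap, S.cl.preimage e.T.continuous, fun a x hx => by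
    change e.T _ ∈ S.K
    rw [e.comm]
    exact S.inv a _ hx⟩
  rcases h.2 S' with h1 | h1
  · left
    rw [Submodule.eq_bot_iff]
    intro y hy
    obtain ⟨x, rfl⟩ := he y
    have : x ∈ S'.K := hy
    rw [h1] at this
    rw [(Submodule.mem_bot ℂ).1 this, map_zero]
  · right
    rw [Submodule.eq_top_iff']
    intro y
    obtain ⟨x, rfl⟩ := he y
    have : x ∈ S'.K := by rw [h1]; trivial
    exact this
end irr
end

open Classical
noncomputable section
open scoped InnerProductSpace ComplexConjugate

section Fun
variable {A B C : Type} [NonUnitalCStarAlgebra A] [NonUnitalCStarAlgebra B]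
  [NonUnitalCStarAlgebra C]

/-- a closed-range lemma -/
lemma Emb.surj_of_tot {ι : Type} {H K : HRep A} (e : Emb H K) (f : ι → H.H)
    (hg : Tot fun i => e.T (f i)) : Function.Surjective e.T := by
  intro y
  have h2 := Spl.res (f := e.rng.compl.inc) (e := e) (fun x y => ?_) (fun z h1 h2 => hg z fun i => h1 _) y
  · have h3 : e.rng.compl.inc.T (ContinuousLinearMap.adjoint e.rng.compl.inc.T y) = 0 := by
      apply hg
      intro i
      exact (Submodule.mem_orthogonal _ _).1 (e.rng.compl.inc_mem _) _ ⟨f i, rfl⟩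
    rw [h3, add_zero] at h2
    exact ⟨_, h2.symm⟩
  · exact (Submodule.mem_orthogonal _ _).1 (e.rng.compl.inc_mem y) _ ⟨x, rfl⟩

def TT (R : Corr A B) (H : HRep B) : HRep A := (exists_tensor R H).choose

def tt (R : Corr A B) (H : HRep B) : R.X → H.H →L[ℂ] (TT R H).H :=
  (exists_tensor R H).choose_spec.choose

variable (R : Corr A B) (H : HRep B)

lemma tt_inner (r r' : R.X) (h h' : H.H) :
    ⟪tt R H r h, tt R H r' h'⟫_ℂ = ⟪h, H.π (R.ip r r') h'⟫_ℂ :=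
  (exists_tensor R H).choose_spec.choose_spec.1 r r' h h'

lemma tt_act (a : A) (r : R.X) (h : H.H) : (TT R H).π a (tt R H r h) = tt R H (R.φ a r) h :=
  (exists_tensor R H).choose_spec.choose_spec.2.1 a r h

lemma tt_tot : Tot (fun p : R.X × H.H => tt R H p.1 p.2) :=
  (exists_tensor R H).choose_spec.choose_spec.2.2

lemma tt_ext {z w : (TT R H).H} (h : ∀ r k, ⟪tt R H r k, z⟫_ℂ = ⟪tt R H r k, w⟫_ℂ) : z = w := by
  rw [← sub_eq_zero]
  exact tt_tot R H _ fun p => by rw [inner_sub_right, h, sub_self]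

lemma tt_sm (r : R.X) (b : B) (h : H.H) : tt R H (R.sm r b) h = tt R H r (H.π b h) := by
  apply tt_ext
  intro s k
  rw [tt_inner, tt_inner, R.ip_sm, H.mul_apply]

def ttl (h : H.H) : R.X →L[ℂ] (TT R H).H :=
  (exists_tl R H (tt R H) (tt_inner R H) (tt_tot R H)).choose h

lemma ttl_apply (h : H.H) (r : R.X) : ttl R H h r = tt R H r h :=
  (exists_tl R H (tt R H) (tt_inner R H) (tt_tot R H)).choose_spec h r

/-- totality restricted to a dense set of `R` -/
lemma tt_zero_of_dense (D : Set R.X) (hD : closure (Submodule.span ℂ D : Set R.X) = Set.univ)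
    (z : (TT R H).H) (hz : ∀ r ∈ D, ∀ h, ⟪tt R H r h, z⟫_ℂ = 0) : z = 0 := by
  apply tt_tot R H
  rintro ⟨r, h⟩
  have hc : IsClosed {r : R.X | ⟪ttl R H h r, z⟫_ℂ = 0} := isClosed_eq (by fun_prop) continuous_const
  have hs : (Submodule.span ℂ D : Set R.X) ⊆ {r : R.X | ⟪ttl R H h r, z⟫_ℂ = 0} := by
    intro u hu
    induction hu using Submodule.span_induction with
    | mem x hx => simp only [Set.mem_ofPred_eq, ttl_apply]; exact hz x hx h
    | zero => simp
    | add x y _ _ hx hy =>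
      simp only [Set.mem_ofPred_eq] at hx hy ⊢; rw [map_add, inner_add_left, hx, hy, add_zero]
    | smul c x _ hx =>
      simp only [Set.mem_ofPred_eq] at hx ⊢; rw [map_smul, inner_smul_left, hx, mul_zero]
  have h3 := closure_minimal hs hc
  rw [hD] at h3
  have := h3 (Set.mem_univ r)
  simpa [ttl_apply] using this

variable {H}
lemma exists_TTmap {K : HRep B} (e : Emb H K) :
    ∃ f : Emb (TT R H) (TT R K), ∀ r h, f.T (tt R H r h) = tt R K r (e.T h) := by
  obtain ⟨T, hT⟩ := (tt_tot R H).exists_isometry (fun p => tt R K p.1 (e.T p.2)) (by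
    intro i j
    rw [tt_inner, tt_inner, ← e.comm, e.iso])
  have hT' : ∀ r h, T (tt R H r h) = tt R K r (e.T h) := fun r h => hT (r, h)
  refine ⟨⟨T.toContinuousLinearMap, fun a x => ?_, fun x y => T.inner_map_map x y⟩, hT'⟩
  have : T.toContinuousLinearMap ∘L (TT R H).π a = (TT R K).π a ∘L T.toContinuousLinearMap := by
    refine (tt_tot R H).clm_ext fun p => ?_
    change T ((TT R H).π a _) = (TT R K).π a (T _)
    rw [tt_act, hT', hT', tt_act]
  exact congrArg (fun U : (TT R H).H →L[ℂ] (TT R K).H => U x) this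

def Emb.map {K : HRep B} (e : Emb H K) : Emb (TT R H) (TT R K) := (exists_TTmap R e).choose
lemma Emb.map_tt {K : HRep B} (e : Emb H K) (r h) :
    (e.map R).T (tt R H r h) = tt R K r (e.T h) := (exists_TTmap R e).choose_spec r h

lemma HIso.map {K : HRep B} (h : HIso H K) : HIso (TT R H) (TT R K) := by
  obtain ⟨e, he⟩ := h
  refine ⟨e.map R, (e.map R).surj_of_tot (fun p : R.X × H.H => tt R H p.1 p.2) ?_⟩
  intro z hz
  apply tt_tot R K
  rintro ⟨r, k⟩
  obtain ⟨h, rfl⟩ := he k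
  have := hz (r, h)
  simp only [e.map_tt] at this
  exact this

lemma HZero.map (h : HZero H) : HZero (TT R H) := by
  intro z
  apply tt_tot R H
  rintro ⟨r, k⟩
  simp [h k]

lemma inner_zero_of_tt {E : Type} [NormedAddCommGroup E] [InnerProductSpace ℂ E] [CompleteSpace E]
    (T : (TT R H).H →L[ℂ] E) (z : E) (hz : ∀ r h, ⟪T (tt R H r h), z⟫_ℂ = 0) (x) :
    ⟪T x, z⟫_ℂ = 0 := by
  have : ContinuousLinearMap.adjoint T z = 0 := by
    apply tt_tot R H
    rintro ⟨r, h⟩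
    rw [ContinuousLinearMap.adjoint_inner_right]
    exact hz r h
  rw [← ContinuousLinearMap.adjoint_inner_right, this, inner_zero_right]

lemma Spl.map {H₁ H₂ : HRep B} (h : Spl H H₁ H₂) : Spl (TT R H) (TT R H₁) (TT R H₂) := by
  obtain ⟨e, f, h1, h2⟩ := h
  refine ⟨e.map R, f.map R, ?_, ?_⟩
  · intro x y
    apply inner_zero_of_tt
    intro r h
    rw [← inner_conj_symm, inner_zero_of_tt, map_zero]
    intro r' h'
    rw [e.map_tt, f.map_tt, tt_inner, ← inner_conj_symm, ← e.comm, h1, map_zero]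
  · intro z hz hz'
    apply tt_tot R H
    rintro ⟨r, k⟩
    change ⟪tt R H r k, z⟫_ℂ = 0
    rw [Spl.res h1 h2 k, map_add, inner_add_left, ← e.map_tt, ← f.map_tt, hz, hz', add_zero]

variable (H)
lemma TT_assoc (R : Corr A B) (S : Corr B C) (X : Corr A C) (h : IsTensorProd R S X) (H : HRep C) :
    HIso (TT X H) (TT R (TT S H)) := by
  obtain ⟨τ, h⟩ := h
  have ht1 : Tot (fun p : R.X × S.X × H.H => tt X H (τ p.1 p.2.1) p.2.2) := by
    intro z hz
    apply tt_zero_of_dense X H _ h.dense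
    rintro _ ⟨r, s, rfl⟩ k
    exact hz (r, s, k)
  have ht2 : Tot (fun p : R.X × S.X × H.H => tt R (TT S H) p.1 (tt S H p.2.1 p.2.2)) := by
    intro z hz
    apply tt_tot R (TT S H)
    rintro ⟨r, k⟩
    apply inner_zero_of_tt S (tt R (TT S H) r) z
    intro s k
    exact hz (r, s, k)
  obtain ⟨T, hT⟩ := ht1.exists_isometry (fun p => tt R (TT S H) p.1 (tt S H p.2.1 p.2.2)) (by
    intro i j
    rw [tt_inner, tt_inner, h.inner, tt_act, tt_inner])
  refine ⟨⟨T.toContinuousLinearMap, fun a x => ?_, fun x y => T.inner_map_map x y⟩, ?_⟩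
  · have : T.toContinuousLinearMap ∘L (TT X H).π a =
        (TT R (TT S H)).π a ∘L T.toContinuousLinearMap := by
      refine ht1.clm_ext fun p => ?_
      change T ((TT X H).π a _) = (TT R (TT S H)).π a (T _)
      rw [tt_act, hT, h.act_left, tt_act]
      exact hT (R.φ a p.1, p.2.1, p.2.2)
    exact congrArg (fun U : (TT X H).H →L[ℂ] (TT R (TT S H)).H => U x) this
  · apply Emb.surj_of_tot _ (fun p : R.X × S.X × H.H => tt X H (τ p.1 p.2.1) p.2.2)
    intro z hz
    apply ht2
    intro p
    exact (congrArg (fun v => ⟪v, z⟫_ℂ) (hT p)).symm.trans (hz p)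

end Fun

section Dec
variable {A B : Type} [NonUnitalCStarAlgebra A] [NonUnitalCStarAlgebra B]

inductive Dec (P : HRep A → Prop) : HRep A → Prop
  | base {H} : P H → Dec P H
  | split {H H₁ H₂} : Spl H H₁ H₂ → Dec P H₁ → Dec P H₂ → Dec P H

lemma Dec.mono {P Q : HRep A → Prop} {H : HRep A} (h : Dec P H) (hPQ : ∀ K, P K → Q K) : Dec Q H := by
  induction h with
  | base h => exact .base (hPQ _ h)
  | split s _ _ h1 h2 => exact .split s h1 h2

lemma Dec.iso {P : HRep A → Prop} (hP : ∀ H K, HIso H K → P H → P K) {H K : HRep A} (h : Dec P H)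
    (hi : HIso H K) : Dec P K := by
  cases h with
  | base h => exact .base (hP _ _ hi h)
  | split s h1 h2 => exact .split (s.of_iso hi) h1 h2

lemma Dec.track {P : HRep A → Prop} {H L : HRep A} (h : Dec P H) (e : Nonempty (Emb H L)) :
    Dec (fun K => P K ∧ Nonempty (Emb K L)) H := by
  induction h with
  | base h => exact .base ⟨h, e⟩
  | split s _ _ h1 h2 =>
    obtain ⟨e⟩ := e
    obtain ⟨i⟩ := s.emb_left
    obtain ⟨j⟩ := s.emb_right
    exact .split s (h1 ⟨i.trans e⟩) (h2 ⟨j.trans e⟩)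

lemma Dec.bind {P : HRep B → Prop} {Q : HRep A → Prop} (R : Corr A B) {H : HRep B} (h : Dec P H)
    (hPQ : ∀ K, P K → Dec Q (TT R K)) : Dec Q (TT R H) := by
  induction h with
  | base h => exact hPQ _ h
  | split s _ _ h1 h2 => exact .split (s.map R) h1 h2

/-- size functions -/
structure Siz (sd : HRep A → ℕ∞) : Prop where
  spl : ∀ H H₁ H₂, Spl H H₁ H₂ → sd H = sd H₁ + sd H₂
  zero : ∀ H, HZero H → sd H = 0
  big : ∀ H, ∃ N : SubR H, sd N.rep = 0 ∧ ∀ L (e : Emb L H), sd L = 0 → ∀ x, e.T x ∈ N.K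

variable {sd : HRep A → ℕ∞}

lemma Siz.iso (hs : Siz sd) {H K : HRep A} (h : HIso H K) : sd H = sd K := by
  rw [hs.spl _ _ _ h.spl, hs.zero _ zrep_zero, add_zero]

lemma Emb.iso_rng {H K : HRep A} (e : Emb H K) : HIso H e.rng.rep := by
  obtain ⟨f, hf⟩ := e.rng.lift e fun x => ⟨x, rfl⟩
  refine ⟨f, fun y => ?_⟩
  obtain ⟨x, hx⟩ := e.rng.inc_mem y
  refine ⟨x, e.rng.inc.inj ?_⟩
  rw [hf]; exact hx

lemma Siz.mono (hs : Siz sd) {H K : HRep A} (e : Emb H K) : sd H ≤ sd K := by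
  rw [hs.iso e.iso_rng, hs.spl K _ _ e.rng.spl]
  exact le_self_add

lemma Siz.dec (hs : Siz sd) (n : ℕ) : ∀ H, sd H ≤ n → Dec (fun K => sd K = 0 ∨ Irr K) H := by
  induction n using Nat.strong_induction_on with
  | _ n ih =>
    intro H hH
    obtain ⟨N, hN0, hN⟩ := hs.big H
    refine .split N.spl (.base (Or.inl hN0)) ?_
    set H' := N.compl.rep with hH'
    by_cases h0 : sd H' = 0
    · exact .base (Or.inl h0)
    by_cases hirr : Irr H'
    · exact .base (Or.inr hirr)
    have hnz : ¬ HZero H' := fun h => h0 (hs.zero _ h)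
    have : ∃ S : SubR H', ¬ S.K = ⊥ ∧ ¬ S.K = ⊤ := by
      by_contra hc
      push Not at hc
      refine hirr ⟨hnz, fun S => ?_⟩
      by_cases h1 : S.K = ⊥
      · exact Or.inl h1
      · exact Or.inr (hc S h1)
    obtain ⟨S, hS1, hS2⟩ := this
    have nk : ∀ S : SubR H', S.K ≠ ⊥ → sd S.rep ≠ 0 := by
      intro S hS h
      apply hS
      rw [Submodule.eq_bot_iff]
      intro x hx
      obtain ⟨y, rfl⟩ := S.exists_inc hx
      have h1 := hN S.rep (S.inc.trans N.compl.inc) h y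
      have h2 : N.compl.inc.T (S.inc.T y) ∈ N.Kᗮ := N.compl.inc_mem _
      have h3 := (N.K.mem_orthogonal _).1 h2 _ h1
      have h4 : N.compl.inc.T (S.inc.T y) = 0 := inner_self_eq_zero.1 h3
      exact N.compl.inc.inj (by rw [h4, map_zero])
    have hSc : S.compl.K ≠ ⊥ := by
      intro h
      apply hS2
      have hcpl : CompleteSpace S.K := S.cl.completeSpace_coe
      exact (Submodule.orthogonal_eq_bot_iff).1 h
    have h1 := nk S hS1
    have h2 := nk _ hSc
    have h3 := hs.spl _ _ _ S.spl
    have h4 : sd H' ≤ n := by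
      have := hs.mono N.compl.inc
      exact this.trans hH
    have f1 : sd S.rep ≠ ⊤ := by
      intro h; rw [h3, h] at h4; simp at h4
    have f2 : sd S.compl.rep ≠ ⊤ := by
      intro h; rw [h3, h] at h4; simp at h4
    obtain ⟨a, ha⟩ := ENat.ne_top_iff_exists.1 f1
    obtain ⟨b, hb⟩ := ENat.ne_top_iff_exists.1 f2
    rw [h3, ← ha, ← hb] at h4
    rw [← ha] at h1
    rw [← hb] at h2
    norm_cast at h1 h2 h4
    exact .split S.spl (ih a (by lia) _ ha.symm.le) (ih b (by lia) _ hb.symm.le)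

end Dec
end

open Classical
noncomputable section
open scoped InnerProductSpace ComplexConjugate

section Good
variable {A B : Type} [NonUnitalCStarAlgebra A] [NonUnitalCStarAlgebra B]

/-- killed, or isomorphic to a listed one -/
def QP (sd : HRep A → ℕ∞) {U : Type} (σ : U → HRep A) (H : HRep A) : Prop :=
  sd H = 0 ∨ ∃ u, HIso (σ u) H

/-- a finite list of irreducibles -/
structure Lst (sd : HRep A → ℕ∞) {U : Type} (σ : U → HRep A) : Prop where
  irr : ∀ u, Irr (σ u)
  sep : ∀ u v, HIso (σ u) (σ v) → u = v
  nk : ∀ u, sd (σ u) ≠ 0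

variable {sd : HRep A → ℕ∞} {U : Type} {σ : U → HRep A}

lemma QP.iso (hs : Siz sd) (H K : HRep A) (hi : HIso H K) : QP sd σ H → QP sd σ K := by
  rintro (h | ⟨u, h⟩)
  · left; rw [← hs.iso hi, h]
  · exact Or.inr ⟨u, h.trans hi⟩

lemma Good.iso (hs : Siz sd) {H K : HRep A} (h : Dec (QP sd σ) H) (hi : HIso H K) :
    Dec (QP sd σ) K := Dec.iso (QP.iso hs) h hi

/-- an irreducible which is not killed has no maps to killed ones -/
lemma hd_killed (hs : Siz sd) {ρ H : HRep A} (hρ : Irr ρ) (h0 : sd ρ ≠ 0) (hH : sd H = 0) :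
    hd ρ H = 0 :=
  hd_zero fun T hT => by
    by_contra hne
    obtain ⟨e, -⟩ := hρ.emb hT hne
    exact h0 (le_antisymm (hH ▸ hs.mono e) bot_le)

lemma Good.adm (hs : Siz sd) (hl : Lst sd σ) {H ρ : HRep A} (h : Dec (QP sd σ) H) (hρ : Irr ρ)
    (h0 : sd ρ ≠ 0) (hh : hd ρ H ≠ 0) : ∃ u, HIso (σ u) ρ := by
  induction h with
  | base h =>
    rcases h with h | ⟨u, h⟩
    · exact (hh (hd_killed hs hρ h0 h)).elim
    · obtain ⟨T, hT, hne⟩ := hd_ne hh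
      exact ⟨u, h.trans (hρ.iso_of_hom ((hl.irr u).of_iso h) hT hne).symm⟩
  | @split K K₁ K₂ s _ _ h1 h2 =>
    rw [hd_spl ρ s] at hh
    by_cases h3 : hd ρ K₁ = 0
    · rw [h3, zero_add] at hh
      exact h2 hh
    · exact h1 h3

lemma Emb.hd_ne {ρ H : HRep A} (e : Emb ρ H) (hρ : Irr ρ) : hd ρ H ≠ 0 := by
  rw [hd_spl ρ e.rng.spl, ← hd_iso ρ e.iso_rng, hρ.hd_one (HIso.refl ρ)]
  simp

/-- good reps are stable under subreps, when finite -/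
lemma Good.sub (hs : Siz sd) (hl : Lst sd σ) {H K : HRep A} (h : Dec (QP sd σ) H) (hf : sd H ≠ ⊤)
    (e : Emb K H) : Dec (QP sd σ) K := by
  have hK : sd K ≠ ⊤ := ne_top_of_le_ne_top hf (hs.mono e)
  obtain ⟨n, hn⟩ := ENat.ne_top_iff_exists.1 hK
  refine ((hs.dec n K hn.symm.le).track ⟨e⟩).mono ?_
  rintro L ⟨hL, ⟨i⟩⟩
  by_cases h0 : sd L = 0
  · exact Or.inl h0
  have hL := hL.resolve_left h0
  exact Or.inr (Good.adm hs hl h hL h0 (i.hd_ne hL))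

lemma hd_list [Fintype U] (hl : Lst sd σ) (u v : U) {H : HRep A} (h : HIso (σ u) H) :
    hd (σ v) H = if v = u then 1 else 0 := by
  split_ifs with hvu
  · subst hvu; exact (hl.irr v).hd_one h
  · exact (hl.irr v).hd_zero ((hl.irr u).of_iso h) fun hc => hvu (hl.sep _ _ (hc.trans h.symm))

lemma Good.fin [Fintype U] (hs : Siz sd) (hl : Lst sd σ) {H : HRep A} (h : Dec (QP sd σ) H)
    (u : U) : hd (σ u) H ≠ ⊤ := by
  induction h with
  | base h =>
    rcases h with h | ⟨v, h⟩
    · rw [hd_killed hs (hl.irr u) (hl.nk u) h]; simp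
    · rw [hd_list hl v u h]; split_ifs <;> simp
  | split s _ _ h1 h2 => rw [hd_spl _ s]; simp [h1, h2]

lemma Good.sd_fin (hs : Siz sd) (hσ : ∀ u, sd (σ u) ≠ ⊤) {H : HRep A}
    (h : Dec (QP sd σ) H) : sd H ≠ ⊤ := by
  induction h with
  | base h =>
    rcases h with h | ⟨v, h⟩
    · rw [h]; simp
    · rw [← hs.iso h]; exact hσ v
  | split s _ _ h1 h2 => rw [hs.spl _ _ _ s]; simp [h1, h2]

/-- the counting lemma -/
lemma Good.count [Fintype U] (hs : Siz sd) (hl : Lst sd σ) {H : HRep A} (h : Dec (QP sd σ) H)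
    (R : Corr B A) (ρ : HRep B) (hρ : ∀ L, sd L = 0 → hd ρ (TT R L) = 0) :
    hd ρ (TT R H) = ∑ u, hd (σ u) H * hd ρ (TT R (σ u)) := by
  induction h with
  | base h =>
    rcases h with h | ⟨v, h⟩
    · rw [hρ _ h]
      simp [hd_killed hs (hl.irr _) (hl.nk _) h]
    · simp only [hd_list hl v _ h]
      simp [hd_iso ρ (h.map R)]
  | split s _ _ h1 h2 =>
    rw [hd_spl _ (s.map R), h1, h2, ← Finset.sum_add_distrib]
    refine Finset.sum_congr rfl fun u _ => ?_
    rw [hd_spl _ s, add_mul]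

/-- orthogonality lemma -/
lemma Good.orth {H K : HRep A} (h : Dec (QP sd σ) H) (e : Emb H K) (z : K.H)
    (h1 : ∀ L (f : Emb L K), sd L = 0 → ∀ x, ⟪f.T x, z⟫_ℂ = 0)
    (h2 : ∀ u (f : Emb (σ u) K) x, ⟪f.T x, z⟫_ℂ = 0) (x) : ⟪e.T x, z⟫_ℂ = 0 := by
  induction h with
  | base h =>
    rcases h with h | ⟨v, i, hi⟩
    · exact h1 _ e h x
    · obtain ⟨y, rfl⟩ := hi x
      exact h2 v (i.trans e) y
  | split s _ _ ih1 ih2 =>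
    obtain ⟨i, j, hij, ht⟩ := s
    rw [Spl.res hij ht x, map_add, inner_add_left]
    have a := ih1 (i.trans e) (ContinuousLinearMap.adjoint i.T x)
    have b := ih2 (j.trans e) (ContinuousLinearMap.adjoint j.T x)
    simp only [Emb.trans, ContinuousLinearMap.comp_apply] at a b
    rw [a, b, add_zero]

/-- extraction of finitely many irreducible pieces -/
lemma exists_pieces {H : HRep A} (h : Dec (fun K => sd K = 0 ∨ Irr K) H) :
    ∃ (ι : Type) (_ : Fintype ι) (τ : ι → HRep A),
      (∀ i, Irr (τ i) ∧ sd (τ i) ≠ 0 ∧ Nonempty (Emb (τ i) H)) ∧ Dec (QP sd τ) H := by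
  induction h with
  | base h =>
    rename_i H
    by_cases h0 : sd H = 0
    · exact ⟨Empty, inferInstance, fun i => i.elim, fun i => i.elim, .base (Or.inl h0)⟩
    · exact ⟨Unit, inferInstance, fun _ => H, fun _ => ⟨h.resolve_left h0, h0, ⟨Emb.refl H⟩⟩,
        .base (Or.inr ⟨(), HIso.refl H⟩)⟩
  | split s _ _ ih1 ih2 =>
    obtain ⟨ι, fι, τ, h1, h2⟩ := ih1
    obtain ⟨κ, fκ, υ, h3, h4⟩ := ih2
    obtain ⟨e⟩ := s.emb_left
    obtain ⟨f⟩ := s.emb_right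
    refine ⟨ι ⊕ κ, inferInstance, Sum.elim τ υ, ?_, .split s (h2.mono ?_) (h4.mono ?_)⟩
    · rintro (i | i)
      · obtain ⟨a, b, ⟨c⟩⟩ := h1 i
        exact ⟨a, b, ⟨c.trans e⟩⟩
      · obtain ⟨a, b, ⟨c⟩⟩ := h3 i
        exact ⟨a, b, ⟨c.trans f⟩⟩
    · rintro K (h | ⟨i, h⟩)
      · exact Or.inl h
      · exact Or.inr ⟨Sum.inl i, h⟩
    · rintro K (h | ⟨i, h⟩)
      · exact Or.inl h
      · exact Or.inr ⟨Sum.inr i, h⟩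

/-- joint version with pairwise non-isomorphic pieces -/
lemma exists_list [Fintype U] (hs : Siz sd) (G : U → HRep A) (hG : ∀ u, sd (G u) ≠ ⊤) :
    ∃ (U' : Type) (_ : Fintype U') (τ : U' → HRep A), Lst sd τ ∧
      (∀ t, ∃ u, Nonempty (Emb (τ t) (G u))) ∧ ∀ u, Dec (QP sd τ) (G u) := by
  have h1 : ∀ u, Dec (fun K => sd K = 0 ∨ Irr K) (G u) := by
    intro u
    obtain ⟨n, hn⟩ := ENat.ne_top_iff_exists.1 (hG u)
    exact hs.dec n _ hn.symm.le
  choose ι fι τ hτ hd using fun u => exists_pieces (h1 u)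
  let τ' : (Σ u, ι u) → HRep A := fun p => τ p.1 p.2
  let st : Setoid (Σ u, ι u) := ⟨fun p q => HIso (τ' p) (τ' q),
    ⟨fun p => HIso.refl _, fun h => h.symm, fun h h' => h.trans h'⟩⟩
  have hout : ∀ p : Σ u, ι u, HIso (τ' (Quotient.mk st p).out) (τ' p) := fun p =>
    Quotient.exact (s := st) (Quotient.out_eq (Quotient.mk st p))
  refine ⟨Quotient st, Fintype.ofFinite _, fun t => τ' t.out, ⟨fun t => (hτ _ _).1, ?_,
    fun t => (hτ _ _).2.1⟩, fun t => ⟨t.out.1, (hτ _ _).2.2⟩, fun u => (hd u).mono ?_⟩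
  · intro u v h
    rw [← Quotient.out_eq u, ← Quotient.out_eq v]
    exact Quotient.sound h
  · rintro K (h | ⟨i, h⟩)
    · exact Or.inl h
    · exact Or.inr ⟨Quotient.mk st ⟨u, i⟩, (hout ⟨u, i⟩).trans h⟩

/-- generated by listed and killed subreps -/
def Gen (sd : HRep A → ℕ∞) {U : Type} (σ : U → HRep A) (K : HRep A) : Prop :=
  ∀ z : K.H, (∀ L (f : Emb L K), sd L = 0 → ∀ x, ⟪f.T x, z⟫_ℂ = 0) →
    (∀ u (f : Emb (σ u) K) x, ⟪f.T x, z⟫_ℂ = 0) → z = 0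

lemma Gen.iso {H K : HRep A} (h : Gen sd σ H) (hi : HIso H K) : Gen sd σ K := by
  obtain ⟨i, hi⟩ := hi
  intro z h1 h2
  obtain ⟨z, rfl⟩ := hi z
  rw [h z, map_zero]
  · intro L f hL x
    rw [← i.iso]
    exact h1 L (f.trans i) hL x
  · intro u f x
    rw [← i.iso]
    exact h2 u (f.trans i) x

/-- stage data -/
structure Stage (X : Corr A A) (U : Type) [Fintype U] (M : Matrix U U ℕ) where
  sd : HRep A → ℕ∞
  σ : U → HRep A
  n : ℕ
  hs : Siz sd
  hl : Lst sd σ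
  fin : ∀ u, sd (σ u) ≠ ⊤
  good : ∀ u, Dec (QP sd σ) (TT X (σ u))
  kill : ∀ L, sd L = 0 → sd (TT X L) = 0
  hM : ∀ u v, (M u v : ℕ∞) = hd (σ v) (TT X (σ u))
  van : ∀ L, sd L = 0 → HZero ((TT X)^[n] L)
  gen : ∀ H, Gen sd σ ((TT X)^[n] H)

lemma iterate_iso (R : Corr A B) (S : Corr B A) (X : Corr A A) (Y : Corr B B)
    (hX : IsTensorProd R S X) (hY : IsTensorProd S R Y) (n : ℕ) (H : HRep B) :
    HIso ((TT Y)^[n + 1] H) (TT S ((TT X)^[n] (TT R H))) := by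
  induction n with
  | zero => exact TT_assoc S R Y hY H
  | succ n ih =>
    rw [Function.iterate_succ_apply' (TT Y) (n + 1), Function.iterate_succ_apply' (TT X) n]
    refine (ih.map Y).trans ((TT_assoc S R Y hY _).trans (HIso.map S ?_))
    exact (TT_assoc R S X hX _).symm

lemma Siz.pull (hs : Siz sd) (R : Corr A B) : Siz (fun H : HRep B => sd (TT R H)) where
  spl := fun H H₁ H₂ h => hs.spl _ _ _ (h.map R)
  zero := fun H h => hs.zero _ (h.map R)
  big := by
    intro H
    obtain ⟨N, hN0, hN⟩ := hs.big (TT R H)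
    let N' : SubR H :=
      { K := ⨅ r : R.X, N.K.comap (tt R H r).toLinearMap
        cl := by
          have : ((⨅ r : R.X, N.K.comap (tt R H r).toLinearMap : Submodule ℂ H.H) : Set H.H) =
              ⋂ r : R.X, (tt R H r) ⁻¹' (N.K : Set _) := by
            rw [Submodule.coe_iInf]; rfl
          rw [this]
          exact isClosed_iInter fun r => N.cl.preimage (tt R H r).continuous
        inv := by
          intro b x hx
          rw [Submodule.mem_iInf] at hx ⊢
          intro r
          change tt R H r (H.π b x) ∈ N.K
          rw [← tt_sm]
          exact hx _ }
    have hN' : ∀ x, x ∈ N'.K ↔ ∀ r, tt R H r x ∈ N.K := fun x => Submodule.mem_iInf _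
    refine ⟨N', ?_, ?_⟩
    · have h1 : ∀ x, (N'.inc.map R).T x ∈ N.K := by
        intro x
        have hcpl : CompleteSpace N.K := N.cl.completeSpace_coe
        rw [← Submodule.orthogonal_orthogonal N.K, Submodule.mem_orthogonal']
        intro u hu
        apply inner_zero_of_tt
        intro r h
        rw [Emb.map_tt]
        exact (N.K.mem_orthogonal _).1 hu _ ((hN' _).1 (N'.inc_mem h) r)
      obtain ⟨f, -⟩ := N.lift (N'.inc.map R) h1
      exact le_antisymm (hN0 ▸ hs.mono f) bot_le
    · intro L e hL x
      rw [hN']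
      intro r
      rw [← e.map_tt]
      exact hN _ (e.map R) hL _

theorem Stage.step [Fintype U] {X : Corr A A} {M : Matrix U U ℕ} (s : Stage X U M)
    (R : Corr A B) (S : Corr B A) (Y : Corr B B) (hX : IsTensorProd R S X)
    (hY : IsTensorProd S R Y) :
    ∃ (U' : Type) (_ : Fintype U') (D : Matrix U U' ℕ) (C : Matrix U' U ℕ),
      M = D * C ∧ Nonempty (Stage Y U' (C * D)) := by
  have hs := s.hs
  have hl := s.hl
  have hs' := hs.pull R
  have hXf : ∀ u, s.sd (TT X (s.σ u)) ≠ ⊤ := fun u => Good.sd_fin hs s.fin (s.good u)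
  have hG : ∀ u, s.sd (TT R (TT S (s.σ u))) ≠ ⊤ := fun u => by
    rw [← hs.iso (TT_assoc R S X hX _)]; exact hXf u
  obtain ⟨U', fU', τ, hl', hemb, hdec⟩ := exists_list hs' (fun u => TT S (s.σ u)) hG
  have hgoodR : ∀ t, Dec (QP s.sd s.σ) (TT R (τ t)) := by
    intro t
    obtain ⟨u, ⟨e⟩⟩ := hemb t
    exact Good.sub hs hl (Good.iso hs (s.good u) (TT_assoc R S X hX _)) (hG u) (e.map R)
  have killS : ∀ L, s.sd L = 0 → s.sd (TT R (TT S L)) = 0 := fun L hL => by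
    rw [← hs.iso (TT_assoc R S X hX _)]; exact s.kill L hL
  let D : Matrix U U' ℕ := fun u t => (hd (τ t) (TT S (s.σ u))).toNat
  let C : Matrix U' U ℕ := fun t u => (hd (s.σ u) (TT R (τ t))).toNat
  have hD : ∀ u t, (D u t : ℕ∞) = hd (τ t) (TT S (s.σ u)) := fun u t =>
    ENat.natCast_toNat (Good.fin hs' hl' (hdec u) t)
  have hC : ∀ t u, (C t u : ℕ∞) = hd (s.σ u) (TT R (τ t)) := fun t u =>
    ENat.natCast_toNat (Good.fin hs hl (hgoodR t) u)
  refine ⟨U', fU', D, C, ?_, ⟨⟨fun H => s.sd (TT R H), τ, s.n + 1, hs', hl', ?_, ?_, ?_, ?_, ?_, ?_⟩⟩⟩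
  · ext u v
    have h1 := Good.count hs' hl' (hdec u) R (s.σ v) (fun L hL =>
      hd_killed hs (hl.irr v) (hl.nk v) hL)
    rw [← hd_iso _ (TT_assoc R S X hX _), ← s.hM] at h1
    simp only [← hD, ← hC] at h1
    rw [Matrix.mul_apply]
    exact_mod_cast h1
  · intro t
    obtain ⟨u, ⟨e⟩⟩ := hemb t
    exact ne_top_of_le_ne_top (hG u) (hs'.mono e)
  · intro t
    refine Good.iso hs' (Dec.bind S (hgoodR t) ?_) (TT_assoc S R Y hY _).symm
    rintro K (h | ⟨u, h⟩)
    · exact .base (Or.inl (killS K h))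
    · exact Good.iso hs' (hdec u) (h.map S)
  · intro L hL
    have h1 : HIso (TT X (TT R L)) (TT R (TT Y L)) :=
      (TT_assoc R S X hX _).trans (HIso.map R (TT_assoc S R Y hY L).symm)
    rw [← hs.iso h1]
    exact s.kill _ hL
  · intro t t'
    have h1 := Good.count hs hl (hgoodR t) S (τ t') (fun L hL =>
      hd_killed hs' (hl'.irr t') (hl'.nk t') (killS L hL))
    rw [hd_iso _ (TT_assoc S R Y hY _), h1, Matrix.mul_apply]
    push_cast
    simp only [hD, hC]
  · intro L hL
    refine HZero.iso ?_ (iterate_iso R S X Y hX hY s.n L).symm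
    exact (s.van _ hL).map S
  · intro H
    refine Gen.iso ?_ (iterate_iso R S X Y hX hY s.n H).symm
    intro z h1 h2
    apply tt_tot S
    rintro ⟨q, k⟩
    change ⟪tt S _ q k, z⟫_ℂ = 0
    rw [← ContinuousLinearMap.adjoint_inner_right]
    have : ContinuousLinearMap.adjoint (tt S ((TT X)^[s.n] (TT R H)) q) z = 0 := by
      apply s.gen
      · intro L f hL x
        rw [ContinuousLinearMap.adjoint_inner_right, ← f.map_tt]
        exact h1 (TT S L) (f.map S) (killS L hL) _
      · intro u f x
        rw [ContinuousLinearMap.adjoint_inner_right, ← f.map_tt]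
        exact Good.orth (hdec u) (f.map S) z h1 h2 _
    rw [this, inner_zero_right]

end Good

theorem stage_sse {A : Type} {iA : NonUnitalCStarAlgebra A} {B : Type}
    {iB : NonUnitalCStarAlgebra B} {X : @Corr A A iA iA} {Y : @Corr B B iB iB} {m : ℕ}
    (h : CorrSSE A iA B iB X Y m) :
    ∀ (U : Type) (fU : Fintype U) (dU : DecidableEq U) (M : Matrix U U ℕ), Nonempty (Stage X U M) →
    ∃ (U' : Type) (fU' : Fintype U') (dU' : DecidableEq U') (M' : Matrix U' U' ℕ),
      Nonempty (Stage Y U' M') ∧ MatSSE U fU dU U' fU' dU' M M' m := by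
  induction h with
  | elem X Y R S hX hY =>
    rintro U fU dU M ⟨s⟩
    obtain ⟨U', fU', D, C, hM, hst⟩ := s.step R S Y hX hY
    exact ⟨U', fU', inferInstance, C * D, hst, MatSSE.elementary M (C * D) D C hM rfl⟩
  | step _ _ ih1 ih2 =>
    intro U fU dU M hs
    obtain ⟨U', fU', dU', M', hs', h1⟩ := ih1 U fU dU M hs
    obtain ⟨U'', fU'', dU'', M'', hs'', h2⟩ := ih2 U' fU' dU' M' hs'
    exact ⟨U'', fU'', dU'', M'', hs'', MatSSE.step h1 h2⟩
end

open Classical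
noncomputable section
open scoped InnerProductSpace ComplexConjugate

section Base
variable {V : Type} [Fintype V]

def pj (v : V) : V → ℂ := fun w => if w = v then 1 else 0

lemma mul_pj (a : V → ℂ) (v : V) : a * pj v = a v • pj v := by
  ext w
  by_cases h : w = v <;> simp [pj, h]

lemma star_pj (v : V) : star (pj v) = pj v := by
  ext w
  by_cases h : w = v <;> simp [pj, h]

lemma pj_mul (v : V) : pj v * pj v = pj v := by rw [mul_pj]; simp [pj]

lemma sum_pj (a : V → ℂ) : a = ∑ v, a v • pj v := by
  ext w
  simp [pj]

def cv (v : V) : HRep (V → ℂ) where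
  H := ℂ
  π :=
  { toFun := fun a => a v • 1
    map_smul' := fun c a => by ext; simp
    map_zero' := by ext; simp
    map_add' := fun a b => by ext; simp
    map_mul' := fun a b => by ext; simp [mul_comm]
    map_star' := fun a => by
      rw [star_smul, star_one]; rfl }
  nd := fun h hh => by simpa using hh 1

def cone (v : V) : (cv v).H := (1 : ℂ)

lemma cv_act (v : V) (a : V → ℂ) (x : (cv v).H) : (cv v).π a x = a v • x := rfl

lemma cv_eq (v : V) (x : (cv v).H) : ∃ c : ℂ, x = c • cone v := by
  refine ⟨(show ℂ from x), ?_⟩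
  exact (mul_one (show ℂ from x)).symm

lemma cone_inner (v : V) : ⟪cone v, cone v⟫_ℂ = 1 := by
  change ⟪(1 : ℂ), (1 : ℂ)⟫_ℂ = 1
  simp

lemma cone_ne (v : V) : cone v ≠ 0 := by
  intro h
  have := cone_inner v
  rw [h, inner_zero_left] at this
  exact zero_ne_one this

lemma cv_irr (v : V) : Irr (cv v) := by
  refine ⟨fun h => cone_ne v (h _), fun S => ?_⟩
  by_cases h : S.K = ⊥
  · exact Or.inl h
  right
  obtain ⟨x, hx, hne⟩ := S.K.ne_bot_iff.1 h
  obtain ⟨c, rfl⟩ := cv_eq v x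
  have hc : c ≠ 0 := by rintro rfl; simp at hne
  rw [Submodule.eq_top_iff']
  intro y
  obtain ⟨d, rfl⟩ := cv_eq v y
  have := S.K.smul_mem (d * c⁻¹) hx
  rwa [smul_smul, mul_assoc, inv_mul_cancel₀ hc, mul_one] at this

/-- the maps out of `cv v` -/
def cvm {v : V} {H : HRep (V → ℂ)} (z : H.H) : (cv v).H →L[ℂ] H.H :=
  ContinuousLinearMap.toSpanSingleton ℂ z

lemma cvm_smul {v : V} {H : HRep (V → ℂ)} (z : H.H) (c : ℂ) :
    (cvm z : (cv v).H →L[ℂ] H.H) (c • cone v) = c • z := by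
  rw [map_smul]
  congr 1
  exact one_smul ℂ z

lemma cvm_one {v : V} {H : HRep (V → ℂ)} (z : H.H) :
    (cvm z : (cv v).H →L[ℂ] H.H) (cone v) = z := one_smul ℂ z

lemma cv_ext {v : V} {H : HRep (V → ℂ)} {S T : (cv v).H →L[ℂ] H.H} (h : S (cone v) = T (cone v)) :
    S = T := by
  refine ContinuousLinearMap.ext fun x => ?_
  obtain ⟨c, rfl⟩ := cv_eq v x
  rw [map_smul, map_smul, h]

lemma cvm_mem {v : V} {H : HRep (V → ℂ)} {z : H.H} (hz : H.π (pj v) z = z) :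
    (cvm z : (cv v).H →L[ℂ] H.H) ∈ HHom (cv v) H := by
  intro a x
  obtain ⟨c, rfl⟩ := cv_eq v x
  rw [cv_act, map_smul, cvm_smul, map_smul, ← hz, ← H.mul_apply, mul_pj, map_smul, smul_apply,
    smul_comm]

lemma hom_pj {v : V} {H : HRep (V → ℂ)} {T : (cv v).H →L[ℂ] H.H} (hT : T ∈ HHom (cv v) H) :
    H.π (pj v) (T (cone v)) = T (cone v) := by
  rw [← hT, cv_act]; simp [pj]

lemma exists_pj {H : HRep (V → ℂ)} {z : H.H} (hz : z ≠ 0) : ∃ v, H.π (pj v) z ≠ 0 := by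
  by_contra hc
  push Not at hc
  apply hz
  apply H.nd
  intro a
  rw [sum_pj a, map_sum, sum_apply]
  refine Finset.sum_eq_zero fun v _ => ?_
  rw [map_smul, smul_apply, hc, smul_zero]

lemma pj_pj (H : HRep (V → ℂ)) (v : V) (z : H.H) : H.π (pj v) (H.π (pj v) z) = H.π (pj v) z := by
  rw [← H.mul_apply, pj_mul]

lemma cv_key {H : HRep (V → ℂ)} {z : H.H} (hz : z ≠ 0) :
    ∃ (v : V) (e : Emb (cv v) H), ⟪e.T (cone v), z⟫_ℂ ≠ 0 := by
  obtain ⟨v, hv⟩ := exists_pj hz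
  have hm := cvm_mem (pj_pj H v z)
  obtain ⟨e, c, hc, he⟩ := (cv_irr v).emb hm (by
    intro h0
    apply hv
    rw [← cvm_one (v := v) (H.π (pj v) z), h0]; rfl)
  refine ⟨v, e, fun h0 => hv ?_⟩
  have h1 : H.π (pj v) z = c • e.T (cone v) := by
    rw [← cvm_one (v := v) (H.π (pj v) z), he]; rfl
  have h2 : ⟪H.π (pj v) z, H.π (pj v) z⟫_ℂ = 0 := by
    rw [H.star_right, star_pj, pj_pj, h1, inner_smul_left, h0, mul_zero]
  exact inner_self_eq_zero.1 h2

lemma irr_cv {ρ : HRep (V → ℂ)} (h : Irr ρ) : ∃ v, HIso (cv v) ρ := by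
  have : ∃ z : ρ.H, z ≠ 0 := by
    by_contra hc
    push Not at hc
    exact h.1 hc
  obtain ⟨z, hz⟩ := this
  obtain ⟨v, e, -⟩ := cv_key hz
  exact ⟨v, h.surj (cv_irr v).1 e⟩

lemma cv_sep (u v : V) (h : HIso (cv u) (cv v)) : u = v := by
  obtain ⟨e, -⟩ := h
  by_contra hne
  have h1 := e.comm (pj u) (cone u)
  rw [cv_act, cv_act] at h1
  have h2 : pj u v = 0 := by simp [pj, Ne.symm hne]
  have h3 : pj u u = 1 := by simp [pj]
  rw [h2, h3, one_smul, zero_smul] at h1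
  exact cone_ne u (e.inj (by rw [h1, map_zero]))

/-- dimension -/
def dm (H : HRep (V → ℂ)) : ℕ∞ := Cardinal.toENat (Module.rank ℂ H.H)

lemma dm_zero {H : HRep (V → ℂ)} (h : dm H = 0) : HZero H := by
  unfold dm at h
  rw [Cardinal.toENat_eq_zero, rank_zero_iff] at h
  exact fun x => Subsingleton.elim _ _

lemma dm_siz : Siz (dm (V := V)) where
  zero := fun H h => by
    have : Subsingleton H.H := ⟨fun x y => by rw [h x, h y]⟩
    unfold dm
    rw [rank_subsingleton']; simp
  spl := by
    rintro H H₁ H₂ ⟨e, f, h1, h2⟩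
    have h1' : ∀ x y, ⟪f.T x, e.T y⟫_ℂ = 0 := fun x y => by rw [← inner_conj_symm, h1, map_zero]
    let Φ : H.H ≃ₗ[ℂ] H₁.H × H₂.H :=
      { toFun := fun z => (ContinuousLinearMap.adjoint e.T z, ContinuousLinearMap.adjoint f.T z)
        map_add' := fun x y => by simp
        map_smul' := fun c x => by simp
        invFun := fun p => e.T p.1 + f.T p.2
        left_inv := fun z => (Spl.res h1 h2 z).symm
        right_inv := fun p => by
          simp only [map_add, e.adj_T, f.adj_T, Spl.adj_zero h1, Spl.adj_zero h1', add_zero,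
            zero_add] }
    unfold dm
    rw [Φ.rank_eq, rank_prod', map_add]
  big := fun H => by
    refine ⟨⟨⊥, isClosed_singleton, fun a x hx => by
      rw [(Submodule.mem_bot ℂ).1 hx, map_zero]; exact Submodule.zero_mem _⟩, ?_, ?_⟩
    · unfold dm
      have : Subsingleton (⊥ : Submodule ℂ H.H) := inferInstance
      change Cardinal.toENat (Module.rank ℂ (⊥ : Submodule ℂ H.H)) = 0
      simp
    · intro L e hL x
      rw [dm_zero hL x, map_zero]; exact Submodule.zero_mem _

instance edge_finite (A : Matrix V V ℕ) : Finite (Edge A) := by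
  let f : Edge A → Σ p : V × V, Fin (A p.1 p.2) := fun e => ⟨(e.1.1, e.1.2.2), ⟨e.1.2.1, e.2⟩⟩
  refine Finite.of_injective f ?_
  rintro ⟨⟨a, b, c⟩, h⟩ ⟨⟨a', b', c'⟩, h'⟩ hf
  simp only [f, Sigma.mk.injEq, Prod.mk.injEq] at hf
  obtain ⟨⟨rfl, rfl⟩, h2⟩ := hf
  have := eq_of_heq h2
  simp only [Fin.mk.injEq] at this
  subst this
  rfl

section GC
variable [DecidableEq V] {A : Matrix V V ℕ} {Z : Corr (V → ℂ) (V → ℂ)} {δ : Edge A → Z.X}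

variable (hδ : (∀ e f, Z.ip (δ e) (δ f)
      = if e = f then (fun v => if v = Edge.src e then 1 else 0) else 0) ∧
    (∀ (a : V → ℂ) e, Z.φ a (δ e) = a (Edge.tgt e) • δ e) ∧
    (∀ e (b : V → ℂ), Z.sm (δ e) b = b (Edge.src e) • δ e) ∧
    closure (Submodule.span ℂ (Set.range δ) : Set Z.X) = Set.univ)

/-- basis vectors -/
def bx (δ : Edge A → Z.X) (v : V) (e : Edge A) : (TT Z (cv v)).H := tt Z (cv v) (δ e) (cone v)

include hδ in
lemma bx_inner (v : V) (e f : Edge A) :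
    ⟪bx δ v e, bx δ v f⟫_ℂ = if e = f ∧ v = e.src then 1 else 0 := by
  unfold bx
  rw [tt_inner, hδ.1, cv_act, inner_smul_right, cone_inner, mul_one]
  by_cases h : e = f <;> simp [h]

include hδ in
lemma bx_act (v : V) (e : Edge A) (a : V → ℂ) :
    (TT Z (cv v)).π a (bx δ v e) = a e.tgt • bx δ v e := by
  unfold bx
  rw [tt_act, hδ.2.1, ← ttl_apply, ← ttl_apply, map_smul]

include hδ in
lemma bx_tot (v : V) (z : (TT Z (cv v)).H) (hz : ∀ e, ⟪bx δ v e, z⟫_ℂ = 0) : z = 0 := by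
  apply tt_zero_of_dense Z (cv v) _ hδ.2.2.2
  rintro _ ⟨e, rfl⟩ x
  obtain ⟨c, rfl⟩ := cv_eq v x
  rw [map_smul, inner_smul_left]
  have := hz e
  unfold bx at this
  rw [this, mul_zero]

include hδ in
lemma bx_fin (v : V) : dm (TT Z (cv v)) ≠ ⊤ := by
  let L : (TT Z (cv v)).H →ₗ[ℂ] (Edge A → ℂ) :=
    LinearMap.pi fun e => (innerSL ℂ (bx δ v e)).toLinearMap
  have hL : Function.Injective L := by
    rw [← LinearMap.ker_eq_bot, LinearMap.ker_eq_bot']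
    intro z hz
    exact bx_tot hδ v z fun e => congrFun hz e
  have : Module.Finite ℂ (TT Z (cv v)).H := Module.Finite.of_injective L hL
  unfold dm
  simp only [ne_eq, Cardinal.toENat_eq_top, not_le]
  exact Module.rank_lt_aleph0 ℂ _

include hδ in
lemma bx_hd (v w : V) : hd (cv w) (TT Z (cv v)) = A v w := by
  let ed : Fin (A v w) → Edge A := fun i => ⟨(v, i, w), i.2⟩
  have hed : ∀ i j, ed i = ed j → i = j := by
    intro i j h
    have h2 := congrArg (fun e : Edge A => e.1.2.1) h
    exact Fin.ext h2
  have hin : ∀ i j, ⟪bx δ v (ed i), bx δ v (ed j)⟫_ℂ = if i = j then 1 else 0 := by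
    intro i j
    rw [bx_inner hδ]
    by_cases h : i = j
    · subst h; rw [if_pos ⟨rfl, rfl⟩, if_pos rfl]
    · have : ed i ≠ ed j := fun h' => h (hed i j h')
      simp [h, this]
  let L : HHom (cv w) (TT Z (cv v)) →ₗ[ℂ] (Fin (A v w) → ℂ) :=
    { toFun := fun T i => ⟪bx δ v (ed i), T.1 (cone w)⟫_ℂ
      map_add' := fun S T => by
        ext i
        change ⟪bx δ v (ed i), S.1 (cone w) + T.1 (cone w)⟫_ℂ = _
        rw [inner_add_right]; rfl
      map_smul' := fun c T => by
        ext i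
        change ⟪bx δ v (ed i), c • T.1 (cone w)⟫_ℂ = _
        rw [inner_smul_right]; rfl }
  have hb : Function.Bijective L := by
    constructor
    · rw [← LinearMap.ker_eq_bot, LinearMap.ker_eq_bot']
      rintro ⟨T, hT⟩ hz
      apply Subtype.ext
      apply cv_ext
      change T (cone w) = 0
      apply bx_tot hδ
      intro e
      by_cases htg : e.tgt = w
      · by_cases hsr : e.src = v
        · obtain ⟨⟨a, i, b⟩, hi⟩ := e
          simp only [Edge.src, Edge.tgt] at hsr htg
          subst hsr htg
          exact congrFun hz ⟨i, hi⟩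
        · have : bx δ v e = 0 := by
            rw [← inner_self_eq_zero (𝕜 := ℂ), bx_inner hδ]
            simp [Ne.symm hsr]
          rw [this, inner_zero_left]
      · rw [← hom_pj hT, HRep.star_right, star_pj, bx_act hδ]
        simp [pj, htg]
    · intro c
      have hm : (TT Z (cv v)).π (pj w) (∑ i, c i • bx δ v (ed i)) = ∑ i, c i • bx δ v (ed i) := by
        rw [map_sum]
        refine Finset.sum_congr rfl fun i _ => ?_
        rw [map_smul, bx_act hδ]
        simp [pj, ed, Edge.tgt]
      refine ⟨⟨_, cvm_mem hm⟩, ?_⟩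
      ext j
      change ⟪bx δ v (ed j), cvm _ (cone w)⟫_ℂ = _
      rw [cvm_one, inner_sum]
      simp [inner_smul_right, hin]
  have h2 := (LinearEquiv.ofBijective L hb).rank_eq
  unfold hd
  rw [h2, rank_fin_fun]
  simp

include hδ in
lemma base_stage : Nonempty (Stage Z V A) := by
  have hl : Lst dm (cv (V := V)) := ⟨cv_irr, cv_sep, fun u h => (cv_irr u).1 (dm_zero h)⟩
  refine ⟨⟨dm, cv, 0, dm_siz, hl, ?_, ?_, ?_, ?_, ?_, ?_⟩⟩
  · intro u
    change Cardinal.toENat (Module.rank ℂ ℂ) ≠ ⊤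
    simp
  · intro u
    obtain ⟨n, hn⟩ := ENat.ne_top_iff_exists.1 (bx_fin hδ u)
    refine (dm_siz.dec n _ hn.symm.le).mono ?_
    rintro K (h | h)
    · exact Or.inl h
    · exact Or.inr (irr_cv h)
  · intro L hL
    exact dm_siz.zero _ ((dm_zero hL).map Z)
  · intro u v
    exact (bx_hd hδ u v).symm
  · intro L hL
    exact dm_zero hL
  · intro H z _ h2
    by_contra hz
    obtain ⟨v, e, he⟩ := cv_key hz
    exact he (h2 v e _)

include hδ in
lemma bx_emb {v w : V} (h : A v w ≠ 0) : Nonempty (Emb (cv w) (TT Z (cv v))) := by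
  have : hd (cv w) (TT Z (cv v)) ≠ 0 := by
    rw [bx_hd hδ]; exact_mod_cast h
  obtain ⟨T, hT, hne⟩ := hd_ne this
  obtain ⟨e, -⟩ := (cv_irr w).emb hT hne
  exact ⟨e⟩

include hδ in
lemma emb_src (hA : MatEssential A) (n : ℕ) : ∀ w, ∃ v, Nonempty (Emb (cv w) ((TT Z)^[n] (cv v))) := by
  induction n with
  | zero => exact fun w => ⟨w, ⟨Emb.refl _⟩⟩
  | succ n ih =>
    intro w
    obtain ⟨u, hu⟩ := hA.2 w
    obtain ⟨e⟩ := bx_emb hδ hu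
    obtain ⟨v, ⟨f⟩⟩ := ih u
    refine ⟨v, ?_⟩
    rw [Function.iterate_succ_apply']
    exact ⟨e.trans (f.map Z)⟩

include hδ in
lemma emb_tgt (hA : MatEssential A) (n : ℕ) : ∀ w, ∃ v, Nonempty (Emb (cv v) ((TT Z)^[n] (cv w))) := by
  induction n with
  | zero => exact fun w => ⟨w, ⟨Emb.refl _⟩⟩
  | succ n ih =>
    intro w
    obtain ⟨v, ⟨f⟩⟩ := ih w
    obtain ⟨u, hu⟩ := hA.1 v
    obtain ⟨e⟩ := bx_emb hδ hu
    refine ⟨u, ?_⟩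
    rw [Function.iterate_succ_apply']
    exact ⟨e.trans (f.map Z)⟩

lemma hd_iso_left {B : Type} [NonUnitalCStarAlgebra B] {ρ σ : HRep B} (h : HIso ρ σ) (H : HRep B) :
    hd ρ H = hd σ H := by
  obtain ⟨f, hf⟩ := h.symm
  obtain ⟨e, he⟩ := id h
  have hee : ∀ y, e.T (ContinuousLinearMap.adjoint e.T y) = y := by
    intro y
    obtain ⟨x, rfl⟩ := he y
    rw [e.adj_T]
  let Φ : HHom ρ H ≃ₗ[ℂ] HHom σ H :=
    { toFun := fun T => ⟨_, HHom.comp T.2 (HHom.adj e.mem)⟩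
      map_add' := fun S T => by refine Subtype.ext ?_; ext x; simp
      map_smul' := fun c T => by refine Subtype.ext ?_; ext x; simp
      invFun := fun T => ⟨_, HHom.comp T.2 e.mem⟩
      left_inv := fun T => by refine Subtype.ext ?_; ext x; simp [e.adj_T]
      right_inv := fun T => by refine Subtype.ext ?_; ext x; simp [hee] }
  unfold hd
  rw [Φ.rank_eq]

include hδ in
lemma final_equiv (hA : MatEssential A) {U : Type} [Fintype U] {M : Matrix U U ℕ}
    (s : Stage Z U M) : ∃ e : U ≃ V, ∀ u v, M u v = A (e u) (e v) := by
  choose g hg using fun u => irr_cv (s.hl.irr u)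
  have hinj : Function.Injective g := by
    intro u v h
    exact s.hl.sep u v ((hg u).symm.trans (h ▸ hg v))
  have hnz : ∀ w, s.sd (cv w) ≠ 0 := by
    intro w h0
    obtain ⟨v, ⟨e⟩⟩ := emb_tgt hδ hA s.n w
    exact cone_ne v (e.inj (by rw [s.van _ h0 (e.T (cone v)), map_zero]))
  have hsurj : Function.Surjective g := by
    intro w
    by_contra hc
    push Not at hc
    obtain ⟨v, ⟨e⟩⟩ := emb_src hδ hA s.n w
    have key : ∀ (L : HRep (V → ℂ)) (f : Emb L ((TT Z)^[s.n] (cv v))),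
        (∀ T ∈ HHom (cv w) L, T = 0) → ∀ x, ⟪f.T x, e.T (cone w)⟫_ℂ = 0 := by
      intro L f h x
      have h1 := h _ (HHom.comp (HHom.adj f.mem) e.mem)
      rw [← ContinuousLinearMap.adjoint_inner_right, ← ContinuousLinearMap.comp_apply, h1]
      exact inner_zero_right _
    have hz := s.gen (cv v) (e.T (cone w)) ?_ ?_
    · exact cone_ne w (e.inj (by rw [hz, map_zero]))
    · intro L f hL
      refine key L f fun T hT => ?_
      by_contra hne
      obtain ⟨i, -⟩ := (cv_irr w).emb hT hne
      exact hnz w (le_antisymm (hL ▸ s.hs.mono i) bot_le)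
    · intro u f
      refine key _ f fun T hT => ?_
      by_contra hne
      have := (cv_irr w).iso_of_hom (s.hl.irr u) hT hne
      exact hc u (cv_sep _ _ ((hg u).trans this.symm))
  refine ⟨Equiv.ofBijective g ⟨hinj, hsurj⟩, fun u v => ?_⟩
  have h1 := s.hM u v
  rw [← hd_iso_left (hg v), ← hd_iso _ ((hg u).map Z), bx_hd hδ] at h1
  exact_mod_cast h1
end GC
end Base

lemma MatSSE.reindex {V : Type} {fV : Fintype V} {dV : DecidableEq V} {U : Type} {fU : Fintype U}
    {dU : DecidableEq U} {A : Matrix V V ℕ} {M : Matrix U U ℕ} {m : ℕ}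
    (h : MatSSE V fV dV U fU dU A M m) :
    ∀ (W : Type) (fW : Fintype W) (dW : DecidableEq W) (e : U ≃ W) (B : Matrix W W ℕ),
      (∀ u v, M u v = B (e u) (e v)) → MatSSE V fV dV W fW dW A B m := by
  induction h with
  | @elementary V fV dV U fU dU A M R S hA hB =>
    intro W fW dW e B hM
    refine MatSSE.elementary A B (R.submatrix id e.symm) (S.submatrix e.symm id) ?_ ?_
    · rw [hA]
      ext i j
      simp only [Matrix.mul_apply, Matrix.submatrix_apply, id]
      exact (Equiv.sum_comp e.symm fun u => R i u * S u j).symm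
    · ext i j
      have h1 := hM (e.symm i) (e.symm j)
      rw [e.apply_symm_apply, e.apply_symm_apply] at h1
      rw [← h1, ← hB]
      simp only [Matrix.mul_apply, Matrix.submatrix_apply, id]
  | step h₁ h₂ ih1 ih2 =>
    intro W fW dW e B hM
    exact MatSSE.step h₁ (ih2 W fW dW e B hM)
end

/-- for finite essential matrices `A`, `B` over `ℕ`, if the graph
correspondences `X(A)` and `X(B)` (over `c(V)` and `c(W)`) are strong shift equivalent with
lag `m` as C*-correspondences, then the matrices `A` and `B` are strong shift equivalent
with lag `m`. -/
theorem stmt19 {V W : Type} [fV : Fintype V] [dV : DecidableEq V]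
    [fW : Fintype W] [dW : DecidableEq W]
    (A : Matrix V V ℕ) (B : Matrix W W ℕ)
    (hAess : MatEssential A) (hBess : MatEssential B)
    (ZA : Corr (V → ℂ) (V → ℂ)) (ZB : Corr (W → ℂ) (W → ℂ))
    (hZA : IsGraphCorr A ZA) (hZB : IsGraphCorr B ZB) (m : ℕ)
    (h : CorrSSE (V → ℂ) inferInstance (W → ℂ) inferInstance ZA ZB m) :
    MatSSE V fV dV W fW dW A B m := by
  obtain ⟨δ, hδ⟩ := hZA
  obtain ⟨η, hη⟩ := hZB
  obtain ⟨U, fU, dU, M, ⟨s⟩, hm⟩ := stage_sse h V fV dV A (base_stage hδ)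
  obtain ⟨e, he⟩ := final_equiv hη hBess s
  exact hm.reindex W fW dW e B he
end
end
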